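/- arXiv:1906.06232 — 2 statements merged into one kernel-verified Lean document; each statement's English description precedes it below -/
import Mathlib

section
/- Let M_p be a weight sequence satisfying (M.1), (M.2)' and (M.3)', let f be a Beurling ultradistribution of class (M_p) on ℝ, and let ρ be a positive measurable function on some interval [λ₀,∞) that is O-regularly varying at infinity. Assume that for every φ ∈ D^{(M_p)}(ℝ) with 0 ∉ supp φ there exist C_φ, λ_φ > 0 such that |⟨f(λx),φ(x)⟩| ≤ C_φ ρ(λ) for all λ ≥ λ_φ. Then there exist x₀ > 0, continuous functions f_m : {x ∈ ℝ : |x| > x₀} → ℂ (m ∈ ℕ), and some ℓ > 0, C > 0 such that |f_m(x)| ≤ C (ℓ^m/M_m) |x|^m ρ(|x|) for all |x| > x₀ and m ∈ ℕ, and ⟨f,φ⟩ = Σ_{m=0}^∞ (−1)^m ∫ f_m(x) φ^{(m)}(x) dx (absolutely convergent) for every φ ∈ D^{(M_p)}(ℝ) with supp φ ∩ [−x₀,x₀] = ∅. -/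
open MeasureTheory Real
open scoped BigOperators

noncomputable section

/-- Condition (M.1): a positive, logarithmically convex weight sequence. -/
def IsM1 (M : ℕ → ℝ) : Prop :=
  (∀ p, 0 < M p) ∧ ∀ p : ℕ, 1 ≤ p → (M p) ^ 2 ≤ M (p - 1) * M (p + 1)

/-- Condition (M.2)'. -/
def IsM2' (M : ℕ → ℝ) : Prop :=
  ∃ A H : ℝ, 1 ≤ A ∧ 1 ≤ H ∧ ∀ p : ℕ, M (p + 1) ≤ A * H ^ p * M p

/-- Condition (M.2). -/
def IsM2 (M : ℕ → ℝ) : Prop :=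
  ∃ A H : ℝ, 1 ≤ A ∧ 1 ≤ H ∧ ∀ p q : ℕ, M (p + q) ≤ A * H ^ (p + q) * M p * M q

/-- Condition (M.3)'. -/
def IsM3' (M : ℕ → ℝ) : Prop := Summable fun p : ℕ => M p / M (p + 1)

/-- Condition (M.3). -/
def IsM3 (M : ℕ → ℝ) : Prop :=
  IsM3' M ∧ ∃ c₀ > (0 : ℝ), ∀ q : ℕ, 1 ≤ q →
    (∑' j : ℕ, M (q + j - 1) / M (q + j)) ≤ c₀ * q * (M (q - 1) / M q)

/-- The associated function `M(t) = sup_p log (t^p M 0 / M p)`, with `M(0) = 0`. -/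
def assocFn (M : ℕ → ℝ) (t : ℝ) : ℝ :=
  if t = 0 then 0 else ⨆ p : ℕ, Real.log (t ^ p * M 0 / M p)

/-- The set of quotients defining the norm of `E^{M_p,ℓ}(K)` (one dimension). -/
def ESet1 (M : ℕ → ℝ) (ℓ : ℝ) (K : Set ℝ) (φ : ℝ → ℂ) : Set ℝ :=
  {r | ∃ (m : ℕ) (x : ℝ), x ∈ K ∧ r = ‖iteratedDeriv m φ x‖ / (ℓ ^ m * M m)}

/-- `‖φ‖_{E^{M_p,ℓ}(K)}` (one dimension). -/
def Enorm1 (M : ℕ → ℝ) (ℓ : ℝ) (K : Set ℝ) (φ : ℝ → ℂ) : ℝ := sSup (ESet1 M ℓ K φ)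

/-- Finiteness of `‖φ‖_{E^{M_p,ℓ}(K)}` (one dimension). -/
def EnormFin1 (M : ℕ → ℝ) (ℓ : ℝ) (K : Set ℝ) (φ : ℝ → ℂ) : Prop :=
  BddAbove (ESet1 M ℓ K φ)

/-- Membership in the test space `D^{(M_p)}(ℝ)`. -/
def IsTestD1 (M : ℕ → ℝ) (φ : ℝ → ℂ) : Prop :=
  ContDiff ℝ (⊤ : ℕ∞) φ ∧ HasCompactSupport φ ∧ ∀ ℓ > (0 : ℝ), EnormFin1 M ℓ (tsupport φ) φ

/-- `f` is a Beurling ultradistribution of class `(M_p)` on `ℝ`. -/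
def IsUltraD1 (M : ℕ → ℝ) (f : (ℝ → ℂ) →ₗ[ℂ] ℂ) : Prop :=
  ∀ K : Set ℝ, IsCompact K → ∃ ℓ > (0 : ℝ), ∃ C > (0 : ℝ), ∀ φ : ℝ → ℂ,
    IsTestD1 M φ → tsupport φ ⊆ K → ‖f φ‖ ≤ C * Enorm1 M ℓ K φ

/-- `ρ` is O-regularly varying at infinity. -/
def IsORegVar (ρ : ℝ → ℝ) : Prop :=
  ∀ R : ℝ, 1 < R → ∃ C > (0 : ℝ), ∃ X > (0 : ℝ), ∀ x ≥ X, ∀ l : ℝ,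
    l ∈ Set.Icc (1 / R) R → ρ (l * x) ≤ C * ρ x

section

variable {M : ℕ → ℝ} {φ ψ : ℝ → ℂ} {K : Set ℝ}

/-- `φ` and its derivatives are bounded by `B * ℓ ^ m * M m` on the whole line. -/
def DerivBound (M : ℕ → ℝ) (ℓ B : ℝ) (φ : ℝ → ℂ) : Prop :=
  ∀ (m : ℕ) (x : ℝ), ‖iteratedDeriv m φ x‖ ≤ B * (ℓ ^ m * M m)

lemma iteratedDeriv_eq_zero_of_notMem_tsupport {x : ℝ} (hx : x ∉ tsupport φ) (m : ℕ) :
    iteratedDeriv m φ x = 0 := by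
  have h : iteratedFDeriv ℝ m φ x = 0 :=
    Function.notMem_support.1 fun h => hx (support_iteratedFDeriv_subset m h)
  rw [← norm_eq_zero, ← norm_iteratedFDeriv_eq_norm_iteratedDeriv, h, norm_zero]

lemma isTestD1_iff (hM : ∀ p, 0 < M p) :
    IsTestD1 M φ ↔ ContDiff ℝ (⊤ : ℕ∞) φ ∧ HasCompactSupport φ ∧
      ∀ ℓ > (0 : ℝ), ∃ B, 0 ≤ B ∧ DerivBound M ℓ B φ := by
  refine and_congr_right fun _ => and_congr_right fun _ => forall₂_congr fun ℓ hℓ => ?_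
  have hpos : ∀ m, 0 < ℓ ^ m * M m := fun m => mul_pos (pow_pos hℓ m) (hM m)
  constructor
  · rintro ⟨B, hB⟩
    refine ⟨max B 0, le_max_right _ _, fun m x => ?_⟩
    by_cases hx : x ∈ tsupport φ
    · have := hB ⟨m, x, hx, rfl⟩
      rw [div_le_iff₀ (hpos m)] at this
      exact this.trans (mul_le_mul_of_nonneg_right (le_max_left _ _) (hpos m).le)
    · rw [iteratedDeriv_eq_zero_of_notMem_tsupport hx, norm_zero]
      exact mul_nonneg (le_max_right _ _) (hpos m).le
  · rintro ⟨B, -, hB⟩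
    refine ⟨B, ?_⟩
    rintro _ ⟨m, x, -, rfl⟩
    rw [div_le_iff₀ (hpos m)]
    exact hB m x

lemma IsTestD1.contDiff (h : IsTestD1 M φ) : ContDiff ℝ (⊤ : ℕ∞) φ := h.1

lemma IsTestD1.contDiff_nat (h : IsTestD1 M φ) (n : ℕ) : ContDiff ℝ n φ :=
  h.1.of_le (by exact_mod_cast le_top)

lemma IsTestD1.hasCompactSupport (h : IsTestD1 M φ) : HasCompactSupport φ := h.2.1

lemma IsTestD1.continuous_iteratedDeriv (h : IsTestD1 M φ) (m : ℕ) :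
    Continuous (iteratedDeriv m φ) :=
  (h.contDiff_nat m).continuous_iteratedDeriv m le_rfl

lemma IsTestD1.hasCompactSupport_iteratedDeriv (h : IsTestD1 M φ) (m : ℕ) :
    HasCompactSupport (iteratedDeriv m φ) :=
  h.hasCompactSupport.mono' fun _ hx => by
    by_contra hc
    exact hx (iteratedDeriv_eq_zero_of_notMem_tsupport hc m)

lemma IsTestD1.derivBound (hM : ∀ p, 0 < M p) (h : IsTestD1 M φ) {ℓ : ℝ} (hℓ : 0 < ℓ) :
    ∃ B, 0 ≤ B ∧ DerivBound M ℓ B φ :=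
  ((isTestD1_iff hM).1 h).2.2 ℓ hℓ

lemma IsTestD1.zero (hM : ∀ p, 0 < M p) : IsTestD1 M 0 :=
  (isTestD1_iff hM).2 ⟨contDiff_const, HasCompactSupport.zero, fun _ _ => ⟨0, le_rfl, fun m x => by
    simp [iteratedDeriv_const_zero]⟩⟩

lemma IsTestD1.add (hM : ∀ p, 0 < M p) (h : IsTestD1 M φ) (h' : IsTestD1 M ψ) :
    IsTestD1 M (φ + ψ) := by
  refine (isTestD1_iff hM).2 ⟨h.1.add h'.1, h.2.1.add h'.2.1, fun ℓ hℓ => ?_⟩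
  obtain ⟨B, hB0, hB⟩ := h.derivBound hM hℓ
  obtain ⟨B', hB0', hB'⟩ := h'.derivBound hM hℓ
  refine ⟨B + B', by positivity, fun m x => ?_⟩
  rw [iteratedDeriv_add (h.contDiff_nat m).contDiffAt (h'.contDiff_nat m).contDiffAt, add_mul]
  exact (norm_add_le _ _).trans (add_le_add (hB m x) (hB' m x))

lemma DerivBound.smul {ℓ B : ℝ} (h : DerivBound M ℓ B φ) (c : ℂ) :
    DerivBound M ℓ (‖c‖ * B) (c • φ) := fun m x => by
  rw [iteratedDeriv_const_smul_field, norm_smul, mul_assoc]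
  exact mul_le_mul_of_nonneg_left (h m x) (norm_nonneg c)

lemma IsTestD1.smul (hM : ∀ p, 0 < M p) (h : IsTestD1 M φ) (c : ℂ) : IsTestD1 M (c • φ) := by
  refine (isTestD1_iff hM).2 ⟨h.1.const_smul c, h.2.1.smul_left (f := fun _ => c), fun ℓ hℓ => ?_⟩
  obtain ⟨B, hB0, hB⟩ := h.derivBound hM hℓ
  exact ⟨‖c‖ * B, by positivity, hB.smul c⟩

lemma IsTestD1.sub (hM : ∀ p, 0 < M p) (h : IsTestD1 M φ) (h' : IsTestD1 M ψ) :
    IsTestD1 M (φ - ψ) := by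
  have := h.add hM (h'.smul hM (-1))
  rwa [neg_one_smul, ← sub_eq_add_neg] at this

lemma DerivBound.comp_mul {ℓ B : ℝ} (hφ : ContDiff ℝ (⊤ : ℕ∞) φ) (h : DerivBound M ℓ B φ) (c : ℝ) :
    DerivBound M (|c| * ℓ) B (fun x => φ (c * x)) := fun m x => by
  rw [iteratedDeriv_comp_const_smul (hφ.of_le (by exact_mod_cast le_top)), norm_smul, norm_pow,
    Real.norm_eq_abs, mul_pow]
  calc |c| ^ m * _ ≤ |c| ^ m * (B * (ℓ ^ m * M m)) := by gcongr; exact h m _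
    _ = _ := by ring

lemma IsTestD1.comp_mul (hM : ∀ p, 0 < M p) (h : IsTestD1 M φ) {c : ℝ} (hc : c ≠ 0) :
    IsTestD1 M (fun x => φ (c * x)) := by
  refine (isTestD1_iff hM).2 ⟨h.1.comp (contDiff_const.mul contDiff_id),
    h.2.1.comp_homeomorph (Homeomorph.mulLeft₀ c hc), fun ℓ hℓ => ?_⟩
  obtain ⟨B, hB0, hB⟩ := h.derivBound hM (ℓ := ℓ / |c|) (by positivity)
  have := hB.comp_mul h.1 c
  rw [mul_div_cancel₀ _ (abs_ne_zero.2 hc)] at this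
  exact ⟨B, hB0, this⟩

lemma IsTestD1.comp_add (hM : ∀ p, 0 < M p) (h : IsTestD1 M φ) (c : ℝ) :
    IsTestD1 M (fun x => φ (x + c)) := by
  refine (isTestD1_iff hM).2 ⟨h.1.comp (contDiff_id.add contDiff_const),
    h.2.1.comp_homeomorph (Homeomorph.addRight c), fun ℓ hℓ => ?_⟩
  obtain ⟨B, hB0, hB⟩ := h.derivBound hM hℓ
  refine ⟨B, hB0, fun m x => ?_⟩
  rw [iteratedDeriv_comp_add_const]
  exact hB m _

lemma IsTestD1.conj (hM : ∀ p, 0 < M p) (h : IsTestD1 M φ) :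
    IsTestD1 M (fun x => (starRingEnd ℂ) (φ x)) := by
  refine (isTestD1_iff hM).2 ⟨Complex.conjCLE.contDiff.comp h.1,
    h.2.1.comp_left (map_zero _), fun ℓ hℓ => ?_⟩
  obtain ⟨B, hB0, hB⟩ := h.derivBound hM hℓ
  refine ⟨B, hB0, fun m x => ?_⟩
  have := Complex.conjLIE.norm_iteratedFDeriv_comp_left φ x m
  rw [norm_iteratedFDeriv_eq_norm_iteratedDeriv, norm_iteratedFDeriv_eq_norm_iteratedDeriv] at this
  exact this.trans_le (hB m x)

/-- A compactly supported primitive of a test function is a test function. -/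
lemma IsTestD1.of_hasDerivAt (hM : ∀ p, 0 < M p) (hlog : ∀ p, M p * M 1 ≤ M 0 * M (p + 1))
    (h : IsTestD1 M φ) (hψ : ∀ x, HasDerivAt ψ (φ x) x) (hc : HasCompactSupport ψ) :
    IsTestD1 M ψ := by
  have hd : deriv ψ = φ := funext fun x => (hψ x).deriv
  have hcont : Continuous ψ := continuous_iff_continuousAt.2 fun x => (hψ x).continuousAt
  refine (isTestD1_iff hM).2 ⟨contDiff_infty_iff_deriv.2
    ⟨fun x => (hψ x).differentiableAt, hd ▸ h.1⟩, hc, fun ℓ hℓ => ?_⟩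
  obtain ⟨B, hB0, hB⟩ := h.derivBound hM hℓ
  obtain ⟨D, hD⟩ := hc.exists_bound_of_continuous hcont
  have h0 := hM 0
  have h1 := hM 1
  have hD0 : 0 ≤ D := (norm_nonneg _).trans (hD 0)
  refine ⟨max (D / M 0) (B * M 0 / (M 1 * ℓ)), le_max_of_le_left (by positivity), fun m x => ?_⟩
  have hpos : ∀ m, 0 < ℓ ^ m * M m := fun m => mul_pos (pow_pos hℓ m) (hM m)
  cases m with
  | zero =>
    refine le_trans ?_ (mul_le_mul_of_nonneg_right (le_max_left _ _) (hpos 0).le)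
    simpa [h0.ne'] using hD x
  | succ m =>
    refine le_trans ?_ (mul_le_mul_of_nonneg_right (le_max_right _ _) (hpos _).le)
    rw [iteratedDeriv_succ', hd]
    refine (hB m x).trans ?_
    rw [div_mul_eq_mul_div, le_div_iff₀ (by positivity)]
    calc B * (ℓ ^ m * M m) * (M 1 * ℓ) = B * ℓ ^ (m + 1) * (M m * M 1) := by ring
      _ ≤ B * ℓ ^ (m + 1) * (M 0 * M (m + 1)) :=
        mul_le_mul_of_nonneg_left (hlog m) (by positivity)
      _ = _ := by ring

lemma DerivBound.mul {ℓ B ℓ' B' : ℝ} (hM : ∀ p, 0 < M p)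
    (hlog : ∀ p q, M p * M q ≤ M 0 * M (p + q))
    (hφ : ContDiff ℝ (⊤ : ℕ∞) φ) (hψ : ContDiff ℝ (⊤ : ℕ∞) ψ) (hB : 0 ≤ B) (hB' : 0 ≤ B')
    (hℓ : 0 ≤ ℓ) (hℓ' : 0 ≤ ℓ')
    (h : DerivBound M ℓ B φ) (h' : DerivBound M ℓ' B' ψ) :
    DerivBound M (ℓ + ℓ') (B * B' * M 0) (φ * ψ) := fun m x => by
  rw [iteratedDeriv_mul (hφ.of_le (by exact_mod_cast le_top)).contDiffAt
    (hψ.of_le (by exact_mod_cast le_top)).contDiffAt]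
  refine (norm_sum_le _ _).trans ?_
  rw [add_pow, Finset.sum_mul, Finset.mul_sum]
  refine Finset.sum_le_sum fun i hi => ?_
  have hi : i ≤ m := Nat.lt_succ_iff.1 (Finset.mem_range.1 hi)
  rw [norm_mul, norm_mul, Complex.norm_natCast]
  have h2 := hlog i (m - i)
  rw [Nat.add_sub_cancel' hi] at h2
  have := hM i
  calc _ ≤ (m.choose i : ℝ) * (B * (ℓ ^ i * M i)) * (B' * (ℓ' ^ (m - i) * M (m - i))) := by
        gcongr
        · exact h i x
        · exact h' _ x
    _ = (m.choose i * B * B' * ℓ ^ i * ℓ' ^ (m - i)) * (M i * M (m - i)) := by ring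
    _ ≤ (m.choose i * B * B' * ℓ ^ i * ℓ' ^ (m - i)) * (M 0 * M m) := by gcongr
    _ = _ := by ring

lemma IsTestD1.mul (hM : ∀ p, 0 < M p) (hlog : ∀ p q, M p * M q ≤ M 0 * M (p + q))
    (h : IsTestD1 M φ) (h' : IsTestD1 M ψ) : IsTestD1 M (φ * ψ) := by
  refine (isTestD1_iff hM).2 ⟨h.1.mul h'.1, h.2.1.mul_right, fun ℓ hℓ => ?_⟩
  obtain ⟨B, hB0, hB⟩ := h.derivBound hM (half_pos hℓ)
  obtain ⟨B', hB0', hB'⟩ := h'.derivBound hM (half_pos hℓ)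
  have h0 := hM 0
  refine ⟨B * B' * M 0, by positivity, ?_⟩
  have := hB.mul hM hlog h.1 h'.1 hB0 hB0' (by positivity) (by positivity) hB'
  rwa [add_halves] at this

/-- The product inequality for log-convex sequences. -/
lemma IsM1.mul_le (h : IsM1 M) (p q : ℕ) : M p * M q ≤ M 0 * M (p + q) := by
  obtain ⟨hM, hlc⟩ := h
  have hstep : ∀ n, M (n + 1) / M n ≤ M (n + 2) / M (n + 1) := fun n => by
    have := hlc (n + 1) (by omega)
    rw [div_le_div_iff₀ (hM _) (hM _)]
    simp only [add_tsub_cancel_right] at this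
    nlinarith
  have hmono : Monotone fun n => M (n + 1) / M n := monotone_nat_of_le_succ hstep
  induction q with
  | zero => simp [mul_comm]
  | succ q ih =>
    have h1 : M (q + 1) / M q ≤ M (p + q + 1) / M (p + q) := hmono (by omega)
    have hq := hM q
    have hpq := hM (p + q)
    calc M p * M (q + 1) = M p * M q * (M (q + 1) / M q) := by field_simp
      _ ≤ M 0 * M (p + q) * (M (p + q + 1) / M (p + q)) :=
        mul_le_mul ih h1 (div_nonneg (hM _).le hq.le) (mul_nonneg (hM 0).le hpq.le)
      _ = M 0 * M (p + (q + 1)) := by rw [add_assoc]; field_simp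

/-- The test functions supported in `K`, as a subspace of all functions. -/
def testSubmodule (M : ℕ → ℝ) (hM : ∀ p, 0 < M p) (K : Set ℝ) : Submodule ℂ (ℝ → ℂ) where
  carrier := {φ | IsTestD1 M φ ∧ tsupport φ ⊆ K}
  zero_mem' := ⟨IsTestD1.zero hM, by simp⟩
  add_mem' h h' := ⟨h.1.add hM h'.1, (tsupport_add _ _).trans (Set.union_subset h.2 h'.2)⟩
  smul_mem' c _ h := ⟨h.1.smul hM c,
    (closure_mono (Function.support_const_smul_subset c _)).trans h.2⟩

lemma IsUltraD1.bound (hM : ∀ p, 0 < M p) {f : (ℝ → ℂ) →ₗ[ℂ] ℂ} (hf : IsUltraD1 M f)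
    (hK : IsCompact K) :
    ∃ ℓ > (0 : ℝ), ∃ C > (0 : ℝ), ∀ φ : ℝ → ℂ, IsTestD1 M φ → tsupport φ ⊆ K →
      ∀ B, 0 ≤ B → DerivBound M ℓ B φ → ‖f φ‖ ≤ C * B := by
  obtain ⟨ℓ, hℓ, C, hC, h⟩ := hf K hK
  refine ⟨ℓ, hℓ, C, hC, fun φ hφ hs B hB hb => (h φ hφ hs).trans ?_⟩
  refine mul_le_mul_of_nonneg_left (Real.sSup_le ?_ hB) hC.le
  rintro _ ⟨m, x, -, rfl⟩
  rw [div_le_iff₀ (mul_pos (pow_pos hℓ m) (hM m))]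
  exact hb m x

end

section

variable {M : ℕ → ℝ} {K : Set ℝ}

lemma DerivBound.mono (hM : ∀ p, 0 < M p) {φ : ℝ → ℂ} {ℓ ℓ' B : ℝ} (hℓ : 0 ≤ ℓ) (h : ℓ ≤ ℓ')
    (hB : 0 ≤ B) (hφ : DerivBound M ℓ B φ) : DerivBound M ℓ' B φ := fun m x => by
  refine (hφ m x).trans ?_
  have := hM m
  gcongr

open Topology BoundedContinuousFunction

/-- Countable product of spaces of bounded functions in which the test functions supported in a
compact set embed as a closed subset. -/
abbrev JetSpace : Type := ℕ → (ℕ × ℝ →ᵇ ℂ)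

/-- The function `x ↦ M m * g 0 (m, x)`, the candidate for the `m`-th derivative. -/
def jetCoeff (M : ℕ → ℝ) (g : JetSpace) (m : ℕ) (x : ℝ) : ℂ := M m * g 0 (m, x)

/-- Jets of test functions supported in `K`. -/
def jetSet (M : ℕ → ℝ) (K : Set ℝ) : Set JetSpace :=
  {g | (∀ k m x, (M m : ℂ) * g k (m, x) = ((k : ℂ) + 1) ^ m * jetCoeff M g m x) ∧
    (∀ m x, ∫ t in (0 : ℝ)..x, jetCoeff M g (m + 1) t = jetCoeff M g m x - jetCoeff M g m 0) ∧
    ∀ x ∉ K, jetCoeff M g 0 x = 0}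

lemma continuous_jet_eval (k m : ℕ) (x : ℝ) : Continuous fun g : JetSpace => g k (m, x) :=
  (continuous_eval_const (m, x)).comp (continuous_apply k)

lemma continuous_jetCoeff (m : ℕ) (x : ℝ) : Continuous fun g : JetSpace => jetCoeff M g m x :=
  continuous_const.mul (continuous_jet_eval 0 m x)

lemma continuous_jetCoeff_right (g : JetSpace) (m : ℕ) : Continuous (jetCoeff M g m) :=
  continuous_const.mul ((g 0).continuous.comp (by fun_prop))

lemma continuous_integral_jetCoeff (m : ℕ) (x : ℝ) :
    Continuous fun g : JetSpace => ∫ t in (0 : ℝ)..x, jetCoeff M g m t := by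
  let I : (ℕ × ℝ →ᵇ ℂ) →ₗ[ℂ] ℂ :=
    { toFun := fun u => ∫ t in (0 : ℝ)..x, u (m, t)
      map_add' := fun u v => by
        have hc : ∀ u : ℕ × ℝ →ᵇ ℂ, IntervalIntegrable (fun t => u (m, t)) volume 0 x := fun u =>
          (u.continuous.comp (by fun_prop : Continuous fun t : ℝ => (m, t))).intervalIntegrable _ _
        simpa using intervalIntegral.integral_add (hc u) (hc v)
      map_smul' := fun c u => by simp }
  have hI : Continuous I := by
    refine AddMonoidHomClass.continuous_of_bound I |x| fun u => ?_
    have := intervalIntegral.norm_integral_le_of_norm_le_const (a := (0 : ℝ)) (b := x)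
      (f := fun t => u (m, t)) (C := ‖u‖) fun t _ => u.norm_coe_le_norm _
    rw [sub_zero, mul_comm] at this
    exact this
  have : (fun g : JetSpace => ∫ t in (0 : ℝ)..x, jetCoeff M g m t) = fun g => M m * I (g 0) := by
    funext g
    simp [I, jetCoeff, intervalIntegral.integral_const_mul]
  rw [this]
  exact continuous_const.mul (hI.comp (continuous_apply 0))

lemma isClosed_jetSet : IsClosed (jetSet M K) := by
  have h1 : ∀ k m x, IsClosed {g : JetSpace |
      (M m : ℂ) * g k (m, x) = ((k : ℂ) + 1) ^ m * jetCoeff M g m x} := fun k m x =>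
    isClosed_eq (continuous_const.mul (continuous_jet_eval k m x))
      (continuous_const.mul (continuous_jetCoeff m x))
  have h2 : ∀ m x, IsClosed {g : JetSpace | ∫ t in (0 : ℝ)..x, jetCoeff M g (m + 1) t =
      jetCoeff M g m x - jetCoeff M g m 0} := fun m x =>
    isClosed_eq (continuous_integral_jetCoeff _ x)
      ((continuous_jetCoeff m x).sub (continuous_jetCoeff m 0))
  have h3 : ∀ x, IsClosed {g : JetSpace | jetCoeff M g 0 x = 0} := fun x =>
    isClosed_eq (continuous_jetCoeff 0 x) continuous_const
  have : jetSet M K = (⋂ k, ⋂ m, ⋂ x, {g : JetSpace |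
      (M m : ℂ) * g k (m, x) = ((k : ℂ) + 1) ^ m * jetCoeff M g m x}) ∩
      ((⋂ m, ⋂ x, {g : JetSpace | ∫ t in (0 : ℝ)..x, jetCoeff M g (m + 1) t =
      jetCoeff M g m x - jetCoeff M g m 0}) ∩ ⋂ x ∈ Kᶜ, {g : JetSpace | jetCoeff M g 0 x = 0}) := by
    ext g
    simp [jetSet]
  rw [this]
  exact (isClosed_iInter fun k => isClosed_iInter fun m => isClosed_iInter fun x => h1 k m x).inter
    ((isClosed_iInter fun m => isClosed_iInter fun x => h2 m x).inter
      (isClosed_biInter fun x _ => h3 x))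

lemma hasDerivAt_jetCoeff {g : JetSpace} (hg : g ∈ jetSet M K) (m : ℕ) (x : ℝ) :
    HasDerivAt (jetCoeff M g m) (jetCoeff M g (m + 1) x) x := by
  have hc := continuous_jetCoeff_right (M := M) g (m + 1)
  have h := intervalIntegral.integral_hasDerivAt_right (hc.intervalIntegrable 0 x)
    (hc.stronglyMeasurableAtFilter _ _) hc.continuousAt
  have he : jetCoeff M g m =
      fun x => (∫ t in (0 : ℝ)..x, jetCoeff M g (m + 1) t) + jetCoeff M g m 0 := by
    funext y
    rw [hg.2.1 m y, sub_add_cancel]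
  rw [he]
  exact h.add_const _

lemma iteratedDeriv_jetCoeff {g : JetSpace} (hg : g ∈ jetSet M K) (m : ℕ) :
    iteratedDeriv m (jetCoeff M g 0) = jetCoeff M g m := by
  induction m with
  | zero => exact iteratedDeriv_zero
  | succ m ih =>
    rw [iteratedDeriv_succ, ih]
    exact funext fun x => (hasDerivAt_jetCoeff hg m x).deriv

lemma jet_apply (hM : ∀ p, 0 < M p) {g : JetSpace} (hg : g ∈ jetSet M K) (k m : ℕ) (x : ℝ) :
    g k (m, x) = ((k : ℂ) + 1) ^ m / M m * iteratedDeriv m (jetCoeff M g 0) x := by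
  have hMC : (M m : ℂ) ≠ 0 := by exact_mod_cast (hM m).ne'
  rw [iteratedDeriv_jetCoeff hg, div_mul_eq_mul_div, eq_div_iff hMC, ← hg.1 k m x, mul_comm]

lemma norm_jet_weight_mul (hM : ∀ p, 0 < M p) (k m : ℕ) (z : ℂ) (B : ℝ) :
    ‖((k : ℂ) + 1) ^ m / M m * z‖ ≤ B ↔ ‖z‖ ≤ B * ((1 / ((k : ℝ) + 1)) ^ m * M m) := by
  have hk : ‖(k : ℂ) + 1‖ = (k : ℝ) + 1 := by
    rw [← Nat.cast_succ, Complex.norm_natCast, Nat.cast_succ]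
  have hm := hM m
  have hpos : (0 : ℝ) < ((k : ℝ) + 1) ^ m := by positivity
  rw [norm_mul, norm_div, norm_pow, hk, Complex.norm_of_nonneg hm.le, div_mul_eq_mul_div,
    div_le_iff₀ hm, one_div, inv_pow, mul_left_comm, inv_mul_eq_div, le_div_iff₀ hpos, mul_comm]

lemma tsupport_jetCoeff (hK : IsClosed K) {g : JetSpace} (hg : g ∈ jetSet M K) :
    tsupport (jetCoeff M g 0) ⊆ K :=
  closure_minimal (fun x hx => by_contra fun h => hx (hg.2.2 x h)) hK

lemma isTestD1_jetCoeff (hM : ∀ p, 0 < M p) (hK : IsCompact K) {g : JetSpace}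
    (hg : g ∈ jetSet M K) : IsTestD1 M (jetCoeff M g 0) := by
  refine (isTestD1_iff hM).2 ⟨contDiff_of_differentiable_iteratedDeriv fun m _ => ?_,
    hK.of_isClosed_subset (isClosed_tsupport _) (tsupport_jetCoeff hK.isClosed hg), fun ℓ hℓ => ?_⟩
  · rw [iteratedDeriv_jetCoeff hg]
    exact fun x => (hasDerivAt_jetCoeff hg m x).differentiableAt
  · obtain ⟨k, hk⟩ := exists_nat_one_div_lt hℓ
    refine ⟨‖g k‖, norm_nonneg _, DerivBound.mono hM (by positivity) hk.le (norm_nonneg _) ?_⟩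
    intro m x
    rw [← norm_jet_weight_mul hM, ← jet_apply hM hg]
    exact (g k).norm_coe_le_norm _

lemma norm_jet_sub_le_iff (hM : ∀ p, 0 < M p) (hK : IsCompact K) {g g' : JetSpace}
    (hg : g ∈ jetSet M K) (hg' : g' ∈ jetSet M K) (k : ℕ) {B : ℝ} (hB : 0 ≤ B) :
    ‖g k - g' k‖ ≤ B ↔
      DerivBound M (1 / ((k : ℝ) + 1)) B (jetCoeff M g 0 - jetCoeff M g' 0) := by
  rw [BoundedContinuousFunction.norm_le hB, Prod.forall]
  refine forall₂_congr fun m x => ?_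
  rw [iteratedDeriv_sub ((isTestD1_jetCoeff hM hK hg).contDiff_nat m).contDiffAt
    ((isTestD1_jetCoeff hM hK hg').contDiff_nat m).contDiffAt, ← norm_jet_weight_mul hM,
    mul_sub, ← jet_apply hM hg, ← jet_apply hM hg', BoundedContinuousFunction.sub_apply]

lemma exists_jet (hM : ∀ p, 0 < M p) {φ : ℝ → ℂ} (hφ : IsTestD1 M φ) (hK : tsupport φ ⊆ K) :
    ∃ g ∈ jetSet M K, jetCoeff M g 0 = φ := by
  have hMC : ∀ m, (M m : ℂ) ≠ 0 := fun m => by exact_mod_cast (hM m).ne'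
  have hcont : ∀ k : ℕ, Continuous fun p : ℕ × ℝ =>
      ((k : ℂ) + 1) ^ p.1 / M p.1 * iteratedDeriv p.1 φ p.2 := fun k => by
    refine continuous_prod_of_discrete_left.2 fun m => ?_
    exact (continuous_const (y := ((k : ℂ) + 1) ^ m / (M m : ℂ))).mul
      (hφ.continuous_iteratedDeriv m)
  choose B hB0 hB using fun k : ℕ =>
    hφ.derivBound hM (ℓ := 1 / ((k : ℝ) + 1)) (by positivity)
  let g : JetSpace := fun k => BoundedContinuousFunction.ofNormedAddCommGroup
    _ (hcont k) (B k) fun p => (norm_jet_weight_mul hM k p.1 _ _).2 (hB k p.1 p.2)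
  have hg : ∀ k m x, g k (m, x) = ((k : ℂ) + 1) ^ m / M m * iteratedDeriv m φ x :=
    fun k m x => rfl
  have hco : ∀ m, jetCoeff M g m = iteratedDeriv m φ := fun m => by
    funext x
    rw [jetCoeff, hg]
    have := hMC m
    field_simp
    simp
  refine ⟨g, ⟨fun k m x => ?_, fun m x => ?_, fun x hx => ?_⟩, ?_⟩
  · rw [hco, hg]
    have := hMC m
    field_simp
  · rw [hco, hco]
    refine intervalIntegral.integral_eq_sub_of_hasDerivAt (fun t _ => ?_)
      ((hφ.continuous_iteratedDeriv _).intervalIntegrable _ _)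
    rw [iteratedDeriv_succ]
    exact (((hφ.contDiff_nat (m + 1)).differentiable_iteratedDeriv m
      (by exact_mod_cast Nat.lt_succ_self m)) t).hasDerivAt
  · rw [hco]
    exact iteratedDeriv_eq_zero_of_notMem_tsupport (fun h => hx (hK h)) 0
  · rw [hco, iteratedDeriv_zero]

/-- **Uniform boundedness principle** for eventually bounded families of functionals on the test
functions supported in a compact set. -/
lemma exists_uniform_bound (hM : ∀ p, 0 < M p) (hK : IsCompact K) (T : ℝ → (ℝ → ℂ) →ₗ[ℂ] ℂ)
    {ρ : ℝ → ℝ} {lam0 : ℝ} (hρ : ∀ x ≥ lam0, 0 < ρ x)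
    (hT : ∀ lam > 0, ∃ ℓ > (0 : ℝ), ∃ C > (0 : ℝ), ∀ φ : ℝ → ℂ, IsTestD1 M φ → tsupport φ ⊆ K →
      ∀ B, 0 ≤ B → DerivBound M ℓ B φ → ‖T lam φ‖ ≤ C * B)
    (hpt : ∀ φ : ℝ → ℂ, IsTestD1 M φ → tsupport φ ⊆ K →
      ∃ C > (0 : ℝ), ∃ Λ > (0 : ℝ), ∀ lam : ℝ, Λ ≤ lam → ‖T lam φ‖ ≤ C * ρ lam) :
    ∃ ℓ > (0 : ℝ), ∃ C > (0 : ℝ), ∃ Λ > (0 : ℝ), ∀ lam, Λ ≤ lam → ∀ φ : ℝ → ℂ,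
      IsTestD1 M φ → tsupport φ ⊆ K → ∀ B, 0 ≤ B → DerivBound M ℓ B φ →
        ‖T lam φ‖ ≤ C * ρ lam * B := by
  have hcl : IsClosed (jetSet M K) := isClosed_jetSet
  have : CompleteSpace (jetSet M K) := hcl.completeSpace_coe
  obtain ⟨gz, hgz, -⟩ := exists_jet (K := K) hM (IsTestD1.zero hM) (by simp)
  have : Nonempty (jetSet M K) := ⟨⟨gz, hgz⟩⟩
  have htest : ∀ g : jetSet M K, IsTestD1 M (jetCoeff M g 0) ∧ tsupport (jetCoeff M g 0) ⊆ K :=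
    fun g => ⟨isTestD1_jetCoeff hM hK g.2, tsupport_jetCoeff hK.isClosed g.2⟩
  have hcont : ∀ lam > 0, Continuous fun g : jetSet M K => T lam (jetCoeff M g 0) := by
    intro lam hlam
    obtain ⟨ℓ, hℓ, C, hC, h⟩ := hT lam hlam
    obtain ⟨k, hk⟩ := exists_nat_one_div_lt hℓ
    refine continuous_iff_continuousAt.2 fun g₀ => ?_
    refine tendsto_iff_norm_sub_tendsto_zero.2 ?_
    have hlim : Filter.Tendsto (fun g : jetSet M K => C * ‖(g : JetSpace) k - (g₀ : JetSpace) k‖)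
        (𝓝 g₀) (𝓝 0) := by
      have hc : Continuous fun g : jetSet M K => C * ‖(g : JetSpace) k - (g₀ : JetSpace) k‖ :=
        continuous_const.mul (((continuous_apply k).comp continuous_subtype_val).sub
          continuous_const).norm
      simpa using hc.tendsto g₀
    refine squeeze_zero (fun _ => norm_nonneg _) (fun g => ?_) hlim
    rw [← map_sub]
    refine h _ ((htest g).1.sub hM (htest g₀).1) ?_ _ (norm_nonneg _) ?_
    · exact (tsupport_sub _ _).trans (Set.union_subset (htest g).2 (htest g₀).2)
    · exact DerivBound.mono hM (by positivity) hk.le (norm_nonneg _)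
        ((norm_jet_sub_le_iff hM hK g.2 g₀.2 k (norm_nonneg _)).1 le_rfl)
  let S : ℕ → Set (jetSet M K) := fun n =>
    {g | ∀ lam, (n : ℝ) + 1 ≤ lam → ‖T lam (jetCoeff M g 0)‖ ≤ ((n : ℝ) + 1) * ρ lam}
  have hS : ∀ n, IsClosed (S n) := fun n => by
    have : S n = ⋂ lam, ⋂ _ : (n : ℝ) + 1 ≤ lam,
        {g : jetSet M K | ‖T lam (jetCoeff M g 0)‖ ≤ ((n : ℝ) + 1) * ρ lam} := by
      ext g; simp [S]
    rw [this]
    exact isClosed_iInter fun lam => isClosed_iInter fun hl => isClosed_le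
      (hcont lam (lt_of_lt_of_le (by positivity) hl)).norm continuous_const
  have hU : ⋃ n, S n = Set.univ := by
    refine Set.eq_univ_of_forall fun g => ?_
    obtain ⟨C, hC, Λ, hΛ, h⟩ := hpt _ (htest g).1 (htest g).2
    obtain ⟨n, hn⟩ := exists_nat_ge (max C (max Λ lam0))
    refine Set.mem_iUnion.2 ⟨n, fun lam hlam => (h lam ?_).trans ?_⟩
    · linarith [(le_max_left Λ lam0).trans (le_max_right C _)]
    · refine mul_le_mul_of_nonneg_right ?_ (hρ lam ?_).le
      · linarith [le_max_left C (max Λ lam0)]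
      · linarith [(le_max_right Λ lam0).trans (le_max_right C _)]
  obtain ⟨n, g₀, hg₀⟩ := nonempty_interior_of_iUnion_of_closed hS hU
  rw [mem_interior_iff_mem_nhds, mem_nhds_subtype] at hg₀
  obtain ⟨u, hu, hus⟩ := hg₀
  rw [nhds_pi, Filter.mem_pi] at hu
  obtain ⟨I, hI, t, ht, htu⟩ := hu
  choose ε hε hεt using fun i => Metric.mem_nhds_iff.1 (ht i)
  obtain ⟨k, hk⟩ := hI.bddAbove
  obtain ⟨δ, hδ, hδε⟩ : ∃ δ > 0, ∀ i ∈ I, δ < ε i := by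
    rcases I.eq_empty_or_nonempty with rfl | hne
    · exact ⟨1, one_pos, by simp⟩
    · obtain ⟨i, hi, hmin⟩ := Set.exists_min_image I ε hI hne
      exact ⟨ε i / 2, half_pos (hε i), fun j hj => (half_lt_self (hε i)).trans_le (hmin j hj)⟩
  have hg₀S : g₀ ∈ S n := hus (htu fun i _ => mem_of_mem_nhds (ht i))
  have hmain : ∀ lam, (n : ℝ) + 1 ≤ lam → ∀ φ : ℝ → ℂ, IsTestD1 M φ → tsupport φ ⊆ K →
      DerivBound M (1 / ((k : ℝ) + 1)) δ φ → ‖T lam φ‖ ≤ 2 * ((n : ℝ) + 1) * ρ lam := by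
    intro lam hlam φ hφ hs hb
    obtain ⟨g, hg, hgφ⟩ := exists_jet (K := K) hM ((htest g₀).1.add hM hφ)
      ((tsupport_add _ _).trans (Set.union_subset (htest g₀).2 hs))
    have hgS : (⟨g, hg⟩ : jetSet M K) ∈ S n := by
      refine hus (htu fun i hi => hεt i ?_)
      rw [mem_ball_iff_norm]
      refine lt_of_le_of_lt ?_ (hδε i hi)
      rw [norm_jet_sub_le_iff hM hK hg g₀.2 i hδ.le, hgφ, add_sub_cancel_left]
      have hik : (i : ℝ) ≤ k := by exact_mod_cast hk hi
      exact hb.mono hM (by positivity) (one_div_le_one_div_of_le (by positivity) (by linarith)) hδ.le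
    have h1 := hgS lam hlam
    have h2 := hg₀S lam hlam
    simp only [hgφ] at h1
    have h3 : T lam φ = T lam (jetCoeff M g₀ 0 + φ) - T lam (jetCoeff M g₀ 0) := by
      rw [map_add, add_sub_cancel_left]
    rw [h3]
    exact (norm_sub_le _ _).trans (by linarith)
  refine ⟨1 / ((k : ℝ) + 1), by positivity, 2 * ((n : ℝ) + 1) / δ, by positivity, (n : ℝ) + 1,
    by positivity, fun lam hlam φ hφ hs B hB hb => ?_⟩
  rcases hB.eq_or_lt with rfl | hB
  · have : φ = 0 := funext fun x => by simpa using hb 0 x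
    simp [this]
  have h := hmain lam hlam (((δ / B : ℝ) : ℂ) • φ) (hφ.smul hM _)
    ((closure_mono (Function.support_const_smul_subset _ _)).trans hs) (by
      have := hb.smul ((δ / B : ℝ) : ℂ)
      rwa [Complex.norm_of_nonneg (by positivity), div_mul_cancel₀ _ hB.ne'] at this)
  rw [map_smul, norm_smul, Complex.norm_of_nonneg (by positivity), div_mul_eq_mul_div,
    div_le_iff₀ hB] at h
  rw [div_mul_eq_mul_div, div_mul_eq_mul_div, le_div_iff₀ hδ]
  linarith

end

section

variable {M : ℕ → ℝ} {K : Set ℝ}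

open scoped ENNReal

lemma integral_norm_le_of_L2 {μ : Measure ℝ} [IsFiniteMeasure μ] (u : Lp ℂ 2 μ) :
    ∫ x, ‖u x‖ ∂μ ≤ √(μ.real Set.univ) * ‖u‖ := by
  have h := eLpNorm_le_eLpNorm_mul_rpow_measure_univ (p := 1) (q := 2) (μ := μ) (f := u)
    one_le_two (Lp.aestronglyMeasurable u)
  have hfin : eLpNorm u 2 μ * μ Set.univ ^ (1 / (1 : ℝ≥0∞).toReal - 1 / (2 : ℝ≥0∞).toReal) ≠ ⊤ :=
    ENNReal.mul_ne_top (Lp.eLpNorm_ne_top u)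
      (ENNReal.rpow_ne_top_of_nonneg (by norm_num) (measure_ne_top _ _))
  have h' := ENNReal.toReal_mono hfin h
  rw [ENNReal.toReal_mul, ← Lp.norm_def, ← ENNReal.toReal_rpow] at h'
  rw [integral_norm_eq_lintegral_enorm (Lp.aestronglyMeasurable u), ← eLpNorm_one_eq_lintegral_enorm,
    mul_comm, Real.sqrt_eq_rpow]
  convert h' using 3
  · rfl
  · norm_num

lemma integral_mul_integral_Iic {μ : Measure ℝ} [SFinite μ] {g w : ℝ → ℂ} (hg : Integrable g μ)
    (hw : Integrable w μ) :
    ∫ x, g x * (∫ t in Set.Iic x, w t ∂μ) ∂μ = ∫ t, (∫ x in Set.Ici t, g x ∂μ) * w t ∂μ := by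
  have hms : MeasurableSet {p : ℝ × ℝ | p.2 ≤ p.1} := measurableSet_le measurable_snd measurable_fst
  have hF : Integrable (Function.uncurry fun x t =>
      {p : ℝ × ℝ | p.2 ≤ p.1}.indicator (fun p => g p.1 * w p.2) (x, t)) (μ.prod μ) :=
    (hg.mul_prod hw).indicator hms
  have hswap := integral_integral_swap hF
  convert hswap using 1
  · refine integral_congr_ae (Filter.Eventually.of_forall fun x => ?_)
    simp only
    rw [← integral_const_mul, ← integral_indicator measurableSet_Iic]
    rfl
  · refine integral_congr_ae (Filter.Eventually.of_forall fun t => ?_)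
    simp only
    rw [← integral_mul_const, ← integral_indicator measurableSet_Ici]
    rfl

lemma continuous_integral_Ici {μ : Measure ℝ} [NullSingletonClass μ] {g : ℝ → ℂ}
    (hg : Integrable g μ) :
    Continuous fun t => ∫ x in Set.Ici t, g x ∂μ := by
  have h : (fun t => ∫ x in Set.Ici t, g x ∂μ) =
      fun t => (∫ x in Set.Ioi (0 : ℝ), g x ∂μ) - ∫ x in (0 : ℝ)..t, g x ∂μ := by
    funext t
    rw [integral_Ici_eq_integral_Ioi, eq_sub_iff_add_eq, add_comm]
    exact intervalIntegral.integral_interval_add_Ioi hg.integrableOn hg.integrableOn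
  rw [h]
  exact continuous_const.sub
    (intervalIntegral.continuous_primitive (fun _ _ => hg.intervalIntegrable) 0)

lemma iteratedDeriv_eq_zero_of_notMem {φ : ℝ → ℂ} (hs : tsupport φ ⊆ K) (m : ℕ) {x : ℝ}
    (hx : x ∉ K) : iteratedDeriv m φ x = 0 :=
  iteratedDeriv_eq_zero_of_notMem_tsupport (fun h => hx (hs h)) m

lemma integral_Iic_iteratedDeriv {φ : ℝ → ℂ} (hφ : IsTestD1 M φ)
    (hs : tsupport φ ⊆ K) (m : ℕ) (x : ℝ) :
    ∫ t in Set.Iic x, iteratedDeriv (m + 1) φ t ∂(volume.restrict K) = iteratedDeriv m φ x := by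
  have h1 : ContDiff ℝ 1 (iteratedDeriv m φ) := by
    rw [iteratedDeriv_eq_iterate]
    exact (hφ.contDiff.iterate_deriv m).of_le (by exact_mod_cast le_top)
  rw [Measure.restrict_comm measurableSet_Iic, setIntegral_eq_integral_of_forall_compl_eq_zero
    fun t ht => iteratedDeriv_eq_zero_of_notMem hs _ ht, iteratedDeriv_succ]
  exact HasCompactSupport.integral_Iic_deriv_eq h1 (hφ.hasCompactSupport_iteratedDeriv m) x

/-- Rescaled jet of a test function in the Hilbert sum of copies of `L²(K)`. -/
lemma exists_jetL2 (hM : ∀ p, 0 < M p) (hK : IsCompact K) {s : ℝ} (hs : 0 < s) :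
    ∃ v : testSubmodule M hM K →ₗ[ℂ] lp (fun _ : ℕ => Lp ℂ 2 (volume.restrict K)) 2,
      ∀ φ n, v φ n =ᵐ[volume.restrict K] fun x => ((s ^ n / M n : ℝ) : ℂ) *
        iteratedDeriv n (φ : ℝ → ℂ) x := by
  have : IsFiniteMeasure (volume.restrict K) := ⟨by simpa using hK.measure_lt_top⟩
  have hmem : ∀ (φ : testSubmodule M hM K) (n : ℕ),
      MemLp (fun x => ((s ^ n / M n : ℝ) : ℂ) * iteratedDeriv n (φ : ℝ → ℂ) x) 2
        (volume.restrict K) := fun φ n =>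
    ((φ.2.1.continuous_iteratedDeriv n).memLp_of_hasCompactSupport
      (φ.2.1.hasCompactSupport_iteratedDeriv n)).const_mul _
  let w : testSubmodule M hM K → ∀ _ : ℕ, Lp ℂ 2 (volume.restrict K) := fun φ n => (hmem φ n).toLp _
  have hw : ∀ φ, Memℓp (w φ) 2 := fun φ => by
    obtain ⟨B, hB0, hB⟩ := φ.2.1.derivBound hM (ℓ := 1 / (2 * s)) (by positivity)
    set c := (volume.restrict K).real Set.univ ^ (2 : ℝ≥0∞).toReal⁻¹
    have hc : 0 ≤ c := by positivity
    have hn : ∀ n, ‖w φ n‖ ≤ c * B * (1 / 2) ^ n := fun n => by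
      have h0 : 0 ≤ B * (1 / 2 : ℝ) ^ n := by positivity
      have := Lp.norm_le_of_ae_bound (f := w φ n) h0 (by
        filter_upwards [(hmem φ n).coeFn_toLp] with x hx
        rw [hx, norm_mul, Complex.norm_of_nonneg (div_nonneg (by positivity) (hM n).le)]
        have hMn := hM n
        calc _ ≤ s ^ n / M n * (B * ((1 / (2 * s)) ^ n * M n)) := by gcongr; exact hB n x
          _ = _ := by
            have hsp : s ^ n ≠ 0 := by positivity
            rw [one_div, one_div, mul_inv, mul_pow, inv_pow s]
            field_simp)
      rwa [← mul_assoc] at this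
    refine memℓp_gen (Summable.of_nonneg_of_le (fun n => by positivity) (fun n => ?_)
      ((summable_geometric_of_lt_one (r := (1 / 4 : ℝ)) (by norm_num) (by norm_num)).mul_left
        ((c * B) ^ 2)))
    rw [ENNReal.toReal_ofNat, Real.rpow_ofNat]
    calc _ ≤ (c * B * (1 / 2) ^ n) ^ 2 := pow_le_pow_left₀ (norm_nonneg _) (hn n) 2
      _ = _ := by rw [mul_pow, ← pow_mul, mul_comm n 2, pow_mul]; norm_num
  refine ⟨{ toFun := fun φ => ⟨w φ, hw φ⟩, map_add' := fun φ ψ => ?_, map_smul' := fun c φ => ?_ },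
    fun φ n => (hmem φ n).coeFn_toLp⟩
  · ext1
    funext n
    refine (MemLp.toLp_congr (hmem (φ + ψ) n) ((hmem φ n).add (hmem ψ n)) ?_).trans
      (MemLp.toLp_add (hmem φ n) (hmem ψ n))
    refine Filter.Eventually.of_forall fun x => ?_
    simp only [Submodule.coe_add, Pi.add_apply]
    rw [iteratedDeriv_add (φ.2.1.contDiff_nat n).contDiffAt (ψ.2.1.contDiff_nat n).contDiffAt,
      mul_add]
  · ext1
    funext n
    refine (MemLp.toLp_congr (hmem (c • φ) n) ((hmem φ n).const_smul c) ?_).trans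
      (MemLp.toLp_const_smul c (hmem φ n))
    refine Filter.Eventually.of_forall fun x => ?_
    simp only [Submodule.coe_smul, Pi.smul_apply, iteratedDeriv_const_smul_field, smul_eq_mul]
    ring

end

section

variable {M : ℕ → ℝ} {K : Set ℝ}

lemma LinearMap.exists_eq_inner_of_le {E H : Type*} [AddCommGroup E] [Module ℂ E]
    [NormedAddCommGroup H] [InnerProductSpace ℂ H] [CompleteSpace H] (L : E →ₗ[ℂ] ℂ)
    (v : E →ₗ[ℂ] H) {D : ℝ} (hD : 0 ≤ D) (h : ∀ x, ‖L x‖ ≤ D * ‖v x‖) :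
    ∃ g : H, ‖g‖ ≤ D ∧ ∀ x, L x = inner ℂ g (v x) := by
  obtain ⟨F, hF, hFn⟩ := exists_extension_norm_eq _ (L.compLeftInverse v)
  have hL : ∀ x, L.compLeftInverse v ⟨v x, ⟨x, rfl⟩⟩ = L x := fun x =>
    L.compLeftInverse_apply_of_bdd v ⟨D, h⟩ x _ rfl
  refine ⟨(InnerProductSpace.toDual ℂ H).symm F, ?_, fun x => ?_⟩
  · rw [LinearIsometryEquiv.norm_map, hFn]
    refine ContinuousLinearMap.opNorm_le_bound _ hD ?_
    rintro ⟨_, x, rfl⟩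
    rw [hL]
    exact h x
  · rw [InnerProductSpace.toDual_symm_apply, ← hL]
    exact (hF ⟨v x, ⟨x, rfl⟩⟩).symm

/-- Functionals bounded in a `DerivBound` norm are sums of derivatives of continuous functions. -/
lemma exists_repr (hM : ∀ p, 0 < M p) (h2 : IsM2' M) (hK : IsCompact K) {ℓ : ℝ} (hℓ : 0 < ℓ) :
    ∃ A : ℝ, 0 ≤ A ∧ ∃ s : ℝ, 0 < s ∧ ∀ (C : ℝ) (L : (ℝ → ℂ) →ₗ[ℂ] ℂ), 0 ≤ C →
      (∀ φ, IsTestD1 M φ → tsupport φ ⊆ K → ∀ B, 0 ≤ B → DerivBound M ℓ B φ → ‖L φ‖ ≤ C * B) →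
      ∃ G : ℕ → ℝ → ℂ, (∀ n, Continuous (G n)) ∧ (∀ n x, ‖G n x‖ ≤ C * A * (s ^ n / M n)) ∧
        ∀ φ, IsTestD1 M φ → tsupport φ ⊆ K →
          HasSum (fun n => ∫ x, G n x * iteratedDeriv n φ x) (L φ) := by
  obtain ⟨A, H, hA, hH, hAH⟩ := h2
  have hA0 : 0 < A := one_pos.trans_le hA
  have hH0 : 0 < H := one_pos.trans_le hH
  have : IsFiniteMeasure (volume.restrict K) := ⟨by simpa using hK.measure_lt_top⟩
  set μ := volume.restrict K with hμ
  set c := √(μ.real Set.univ) with hc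
  have hc0 : 0 ≤ c := Real.sqrt_nonneg _
  set s := H / ℓ with hs
  have hs0 : 0 < s := by positivity
  obtain ⟨v, hv⟩ := exists_jetL2 hM hK hs0
  have hint : ∀ u : Lp ℂ 2 μ, Integrable u μ := fun u => (Lp.memLp u).integrable (by norm_num)
  have hMinv : ∀ n, 1 / M n ≤ A * H ^ n / M (n + 1) := fun n => by
    rw [div_le_div_iff₀ (hM n) (hM _), one_mul]
    exact hAH n
  have hder : ∀ φ : testSubmodule M hM K,
      DerivBound M ℓ (c * A / s * ‖v φ‖) (φ : ℝ → ℂ) := fun φ m x => by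
    have hMm := hM m
    have hMm1 := hM (m + 1)
    rw [← integral_Iic_iteratedDeriv φ.2.1 φ.2.2]
    have hi : Integrable (iteratedDeriv (m + 1) (φ : ℝ → ℂ)) μ :=
      ((φ.2.1.continuous_iteratedDeriv _).integrable_of_hasCompactSupport
        (φ.2.1.hasCompactSupport_iteratedDeriv _)).restrict
    have hk : 0 < s ^ (m + 1) / M (m + 1) := by positivity
    calc _ ≤ ∫ t in Set.Iic x, ‖iteratedDeriv (m + 1) (φ : ℝ → ℂ) t‖ ∂μ :=
          norm_integral_le_integral_norm _
      _ ≤ ∫ t, ‖iteratedDeriv (m + 1) (φ : ℝ → ℂ) t‖ ∂μ :=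
          setIntegral_le_integral hi.norm (Filter.Eventually.of_forall fun _ => norm_nonneg _)
      _ = (s ^ (m + 1) / M (m + 1))⁻¹ * ∫ t, ‖v φ (m + 1) t‖ ∂μ := by
          rw [← integral_const_mul]
          refine integral_congr_ae ?_
          filter_upwards [hv φ (m + 1)] with t ht
          rw [ht, norm_mul, Complex.norm_of_nonneg hk.le, inv_mul_cancel_left₀ hk.ne']
      _ ≤ (s ^ (m + 1) / M (m + 1))⁻¹ * (c * ‖v φ‖) := by
          gcongr
          refine (integral_norm_le_of_L2 _).trans ?_
          gcongr
          exact lp.norm_apply_le_norm (by norm_num) _ _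
      _ = M (m + 1) * (c * ‖v φ‖ / s ^ (m + 1)) := by rw [inv_div]; ring
      _ ≤ A * H ^ m * M m * (c * ‖v φ‖ / s ^ (m + 1)) := by
          gcongr
          exact hAH m
      _ = _ := by
          have : ℓ = H / s := by rw [hs]; field_simp
          clear_value s
          rw [this, div_pow, pow_succ]
          field_simp
  refine ⟨c * A / s * (c * A / (s * H)), by positivity, s * H, by positivity,
    fun C L hC hL => ?_⟩
  obtain ⟨g, hgn, hg⟩ := LinearMap.exists_eq_inner_of_le (L.domRestrict (testSubmodule M hM K)) v
    (D := C * (c * A / s)) (by positivity) fun φ => by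
      refine (hL φ φ.2.1 φ.2.2 _ (by positivity) (hder φ)).trans_eq ?_
      ring
  let γ : ℕ → ℝ → ℂ := fun n x => ((s ^ n / M n : ℝ) : ℂ) * (starRingEnd ℂ) (g n x)
  have hγ : ∀ n, Integrable (γ n) μ := fun n =>
    (Complex.conjCLE.toContinuousLinearMap.integrable_comp (hint (g n))).const_mul _
  refine ⟨fun n => n.casesOn 0 fun n t => ∫ x in Set.Ici t, γ n x ∂μ, ?_, ?_, fun φ hφ hφK => ?_⟩
  · rintro (_ | n)
    · exact continuous_zero
    · exact continuous_integral_Ici (hγ n)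
  · rintro (_ | n) x
    · have := hM 0
      change ‖(0 : ℂ)‖ ≤ _
      rw [norm_zero]
      positivity
    · have hMn := hM n
      have hMn' := hM (n + 1)
      calc ‖∫ x in Set.Ici x, γ n x ∂μ‖ ≤ ∫ t in Set.Ici x, ‖γ n t‖ ∂μ :=
            norm_integral_le_integral_norm _
        _ ≤ ∫ t, ‖γ n t‖ ∂μ :=
            setIntegral_le_integral (hγ n).norm (Filter.Eventually.of_forall fun _ => norm_nonneg _)
        _ = s ^ n / M n * ∫ t, ‖g n t‖ ∂μ := by
            rw [← integral_const_mul]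
            refine integral_congr_ae (Filter.Eventually.of_forall fun t => ?_)
            simp only [γ, norm_mul, RCLike.norm_conj]
            rw [Complex.norm_of_nonneg (by positivity)]
        _ ≤ s ^ n / M n * (c * (C * (c * A / s))) := by
            gcongr
            refine (integral_norm_le_of_L2 _).trans ?_
            gcongr
            exact (lp.norm_apply_le_norm (by norm_num) _ _).trans hgn
        _ = 1 / M n * (s ^ n * (c * (C * (c * A / s)))) := by ring
        _ ≤ A * H ^ n / M (n + 1) * (s ^ n * (c * (C * (c * A / s)))) :=
            mul_le_mul_of_nonneg_right (hMinv n) (by positivity)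
        _ = _ := by
            rw [mul_pow, pow_succ, pow_succ]
            field_simp
  · have h0 := lp.hasSum_inner (𝕜 := ℂ) g (v ⟨φ, hφ, hφK⟩)
    rw [← hg] at h0
    suffices h1 : HasSum (fun n => ∫ x, (∫ t in Set.Ici x, γ n t ∂μ) * iteratedDeriv (n + 1) φ x)
        (L φ) by
      refine (hasSum_nat_add_iff' 1).1 ?_
      rw [Finset.sum_range_one]
      change HasSum _ (L φ - ∫ x, (0 : ℂ) * iteratedDeriv 0 φ x)
      simp only [zero_mul, integral_zero, sub_zero]
      exact h1
    refine Eq.mpr (congrArg (HasSum · _) (funext fun n => ?_)) h0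
    have hi : Integrable (iteratedDeriv (n + 1) φ) μ :=
      ((hφ.continuous_iteratedDeriv _).integrable_of_hasCompactSupport
        (hφ.hasCompactSupport_iteratedDeriv _)).restrict
    calc ∫ x, (∫ t in Set.Ici x, γ n t ∂μ) * iteratedDeriv (n + 1) φ x
        = ∫ x, (∫ t in Set.Ici x, γ n t ∂μ) * iteratedDeriv (n + 1) φ x ∂μ :=
          (setIntegral_eq_integral_of_forall_compl_eq_zero fun t ht => by
            rw [iteratedDeriv_eq_zero_of_notMem hφK _ ht, mul_zero]).symm
      _ = ∫ x, γ n x * iteratedDeriv n φ x ∂μ := by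
          rw [← integral_mul_integral_Iic (hγ n) hi]
          simp only [hμ, integral_Iic_iteratedDeriv hφ hφK]
      _ = _ := by
          rw [L2.inner_def]
          refine integral_congr_ae ?_
          filter_upwards [hv ⟨φ, hφ, hφK⟩ n] with x hx
          rw [hx, RCLike.inner_apply]
          simp only [γ]
          ring

end

section

variable {M : ℕ → ℝ} {K : Set ℝ}

lemma HasSum.of_antidiagonal {U : ℕ × ℕ → ℂ} {a : ℂ} (hU : Summable U)
    (h : HasSum (fun n => ∑ p ∈ Finset.HasAntidiagonal.antidiagonal n, U p) a) : HasSum U a := by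
  have h1 := ((Finset.HasAntidiagonal.sigmaAntidiagonalEquivProd (A := ℕ)).hasSum_iff.2
    hU.hasSum).sigma fun n => Finset.hasSum (Finset.HasAntidiagonal.antidiagonal n) U
  rw [h.unique h1]
  exact hU.hasSum

/-- Localisation by a cutoff `χ` of the representation given by `exists_repr`. -/
lemma exists_repr_mul (hM : ∀ p, 0 < M p) (hlog : ∀ p q, M p * M q ≤ M 0 * M (p + q))
    (h2 : IsM2' M) (hK : IsCompact K) {χ : ℝ → ℂ} (hχ : IsTestD1 M χ) (hχK : tsupport χ ⊆ K)
    {ℓ : ℝ} (hℓ : 0 < ℓ) :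
    ∃ A : ℝ, 0 ≤ A ∧ ∃ s : ℝ, 0 < s ∧ ∀ (C : ℝ) (L : (ℝ → ℂ) →ₗ[ℂ] ℂ), 0 ≤ C →
      (∀ φ, IsTestD1 M φ → tsupport φ ⊆ K → ∀ B, 0 ≤ B → DerivBound M ℓ B φ → ‖L φ‖ ≤ C * B) →
      ∃ g : ℕ → ℝ → ℂ, (∀ n, Continuous (g n)) ∧ (∀ n x, ‖g n x‖ ≤ C * A * (s ^ n / M n)) ∧
        (∀ n, ∀ x ∉ K, g n x = 0) ∧
        ∀ φ, IsTestD1 M φ →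
          HasSum (fun n => (-1) ^ n * ∫ x, g n x * iteratedDeriv n φ x) (L (φ * χ)) := by
  obtain ⟨A, hA, s, hs, hAs⟩ := exists_repr hM h2 hK hℓ
  have hh : 0 < 1 / (4 * s) := by positivity
  have hM0 := hM 0
  obtain ⟨B, hB, hχB⟩ := hχ.derivBound hM hh
  refine ⟨A * M 0 * B * 2, by positivity, 2 * s, by positivity, fun C L hC hL => ?_⟩
  obtain ⟨G, hGc, hGb, hG⟩ := hAs C L hC hL
  let w : ℕ → ℕ → ℝ → ℂ := fun k i x =>
    ((k + i).choose k : ℂ) * G (k + i) x * iteratedDeriv i χ x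
  let a : ℕ → ℝ := fun k => C * (A * M 0 * B) * ((2 * s) ^ k / M k)
  have ha : ∀ k, 0 ≤ a k := fun k => by
    have := hM k
    positivity
  have hwb : ∀ k i x, ‖w k i x‖ ≤ a k * (1 / 2) ^ i := fun k i x => by
    have hMk := hM k
    have hMi := hM i
    have hMki := hM (k + i)
    have hq : M i / M (k + i) ≤ M 0 / M k := by
      rw [div_le_div_iff₀ hMki hMk, mul_comm (M i)]
      exact hlog k i
    have hc : ((k + i).choose k : ℝ) ≤ 2 ^ (k + i) := by
      exact_mod_cast Nat.choose_le_two_pow _ _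
    calc ‖w k i x‖ = (k + i).choose k * ‖G (k + i) x‖ * ‖iteratedDeriv i χ x‖ := by
          simp only [w, norm_mul, Complex.norm_natCast]
      _ ≤ 2 ^ (k + i) * (C * A * (s ^ (k + i) / M (k + i))) *
            (B * ((1 / (4 * s)) ^ i * M i)) := by
          gcongr
          · exact hGb _ _
          · exact hχB _ _
      _ = 2 ^ (k + i) * (C * A * s ^ (k + i)) * (B * (1 / (4 * s)) ^ i) * (M i / M (k + i)) := by
          ring
      _ ≤ 2 ^ (k + i) * (C * A * s ^ (k + i)) * (B * (1 / (4 * s)) ^ i) * (M 0 / M k) := by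
          gcongr
      _ = a k * (2 ^ i * s ^ i * (1 / (4 * s)) ^ i) := by
          simp only [a, pow_add, mul_pow]
          ring
      _ = _ := by
          rw [← mul_pow, ← mul_pow]
          congr 2
          field_simp
          norm_num
  have hwc : ∀ k i, Continuous (w k i) := fun k i =>
    (continuous_const.mul (hGc _)).mul (hχ.continuous_iteratedDeriv i)
  have hw0 : ∀ k i, ∀ x ∉ K, w k i x = 0 := fun k i x hx => by
    simp only [w, iteratedDeriv_eq_zero_of_notMem hχK i hx, mul_zero]
  have hgeo : ∀ k, HasSum (fun i : ℕ => a k * (1 / 2) ^ i) (a k * 2) := fun k =>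
    hasSum_geometric_two.mul_left _
  refine ⟨fun k x => (-1) ^ k * ∑' i, w k i x, fun k => ?_, fun k x => ?_, fun k x hx => ?_,
    fun φ hφ => ?_⟩
  · exact continuous_const.mul (continuous_tsum (hwc k) (hgeo k).summable (hwb k))
  · rw [norm_mul, norm_pow, norm_neg, norm_one, one_pow, one_mul]
    refine (tsum_of_norm_bounded (hgeo k) fun i => hwb k i x).trans_eq ?_
    simp only [a]
    ring
  · simp only [hw0 k _ x hx, tsum_zero, mul_zero]
  · obtain ⟨B', hB', hφB⟩ := hφ.derivBound hM hh
    let c := C * (A * M 0 * B) * B'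
    have hub : ∀ k i x, ‖w k i x * iteratedDeriv k φ x‖ ≤ c * ((1 / 2) ^ k * (1 / 2) ^ i) :=
      fun k i x => by
        have hMk := hM k
        have := ha k
        calc _ = ‖w k i x‖ * ‖iteratedDeriv k φ x‖ := norm_mul _ _
          _ ≤ a k * (1 / 2) ^ i * (B' * ((1 / (4 * s)) ^ k * M k)) := by
            gcongr
            · exact hwb k i x
            · exact hφB k x
          _ = c * (((2 * s) * (1 / (4 * s))) ^ k * (1 / 2) ^ i) := by
            simp only [a, c]
            rw [mul_pow (2 * s)]
            field_simp
          _ = _ := by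
            congr 3
            field_simp
            norm_num
    have hui : ∀ k i, Integrable fun x => w k i x * iteratedDeriv k φ x := fun k i =>
      ((hwc k i).mul (hφ.continuous_iteratedDeriv k)).integrable_of_hasCompactSupport
        (hφ.hasCompactSupport_iteratedDeriv k).mul_left
    have hun : ∀ k i, ∫ x, ‖w k i x * iteratedDeriv k φ x‖ ≤
        c * volume.real K * ((1 / 2) ^ k * (1 / 2) ^ i) := fun k i => by
      rw [← setIntegral_eq_integral_of_forall_compl_eq_zero (s := K) fun x hx => by
        rw [hw0 k i x hx, zero_mul, norm_zero]]
      refine (Real.le_norm_self _).trans ((norm_setIntegral_le_of_norm_le_const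
        hK.measure_lt_top fun x _ => ?_).trans_eq (mul_right_comm _ _ _))
      rw [norm_norm]
      exact hub k i x
    have hsum : Summable fun p : ℕ × ℕ => c * volume.real K * ((1 / 2) ^ p.1 * (1 / 2) ^ p.2) :=
      ((summable_geometric_two.mul_of_nonneg summable_geometric_two (fun _ => by positivity)
        fun _ => by positivity)).mul_left _
    have hU : Summable fun p : ℕ × ℕ => ∫ x, w p.1 p.2 x * iteratedDeriv p.1 φ x :=
      hsum.of_norm_bounded fun p => (norm_integral_le_integral_norm _).trans (hun _ _)
    have hφχ : IsTestD1 M (φ * χ) := hφ.mul hM hlog hχ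
    have hT := hG (φ * χ) hφχ ((tsupport_mul_subset_right).trans hχK)
    have hUs : HasSum (fun p : ℕ × ℕ => ∫ x, w p.1 p.2 x * iteratedDeriv p.1 φ x) (L (φ * χ)) := by
      refine HasSum.of_antidiagonal hU ?_
      refine Eq.mpr (congrArg (HasSum · _) (funext fun n => ?_)) hT
      rw [← integral_finsetSum _ fun p _ => hui _ _]
      congr 1
      funext x
      rw [iteratedDeriv_mul (hφ.contDiff_nat n).contDiffAt (hχ.contDiff_nat n).contDiffAt,
        Finset.mul_sum, Finset.Nat.sum_antidiagonal_eq_sum_range_succ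
          (fun k i => w k i x * iteratedDeriv k φ x)]
      refine Finset.sum_congr rfl fun k hk => ?_
      simp only [w, Nat.add_sub_of_le (Nat.lt_succ_iff.1 (Finset.mem_range.1 hk))]
      ring
    refine hUs.prod_fiberwise fun k => ?_
    have hk := hasSum_integral_of_summable_integral_norm (hui k)
      ((hsum.comp_injective (Prod.mk_right_injective k)).of_nonneg_of_le
        (fun i => integral_nonneg fun x => norm_nonneg _) fun i => hun k i)
    refine Eq.mpr (congrArg (HasSum _) ?_) hk
    rw [← integral_const_mul]
    congr 1
    funext x
    rw [tsum_mul_right, ← mul_assoc, ← mul_assoc, ← mul_pow]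
    norm_num

end

section

variable {M : ℕ → ℝ}

lemma exists_mollifier (hM : ∀ p, 0 < M p) (hlog : ∀ p q, M p * M q ≤ M 0 * M (p + q))
    {φ : ℝ → ℂ} (hφ : IsTestD1 M φ) (hne : φ ≠ 0) :
    ∃ ψ : ℝ → ℂ, IsTestD1 M ψ ∧ ∫ x, ψ x = 1 ∧ ∀ x, 1 / 2 ≤ |x| → ψ x = 0 := by
  obtain ⟨x₀, hx₀⟩ := Function.ne_iff.1 hne
  obtain ⟨R, hR, hRφ⟩ := hφ.hasCompactSupport.exists_pos_le_norm
  have hpos : 0 < ∫ x, ‖φ x‖ ^ 2 :=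
    (hφ.contDiff.continuous.norm.pow 2).integral_pos_of_hasCompactSupport_nonneg_nonzero
      (x := x₀) (hφ.hasCompactSupport.comp_left (g := fun z : ℂ => ‖z‖ ^ 2) (by simp))
      (fun x => by positivity) (by simpa using hx₀)
  have hint : ∫ x, (φ * fun x => (starRingEnd ℂ) (φ x)) x = ((∫ x, ‖φ x‖ ^ 2 : ℝ) : ℂ) := by
    rw [← integral_complex_ofReal]
    refine integral_congr_ae (Filter.Eventually.of_forall fun x => ?_)
    simp [Complex.mul_conj']
  have hψ : IsTestD1 M (fun x => (φ * fun x => (starRingEnd ℂ) (φ x)) (2 * R * x)) :=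
    (hφ.mul hM hlog (hφ.conj hM)).comp_mul hM (by positivity)
  have hI : ∫ x, (φ * fun x => (starRingEnd ℂ) (φ x)) (2 * R * x) ≠ 0 := by
    rw [Measure.integral_comp_mul_left, hint]
    exact smul_ne_zero (by positivity) (Complex.ofReal_ne_zero.2 hpos.ne')
  refine ⟨_, hψ.smul hM (∫ x, (φ * fun x => (starRingEnd ℂ) (φ x)) (2 * R * x))⁻¹, ?_,
    fun x hx => ?_⟩
  · simp only [Pi.smul_apply]
    rw [integral_smul, smul_eq_mul, inv_mul_cancel₀ hI]
  · have : φ (2 * R * x) = 0 := hRφ _ (by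
      rw [Real.norm_eq_abs, abs_mul, abs_of_pos (by positivity : 0 < 2 * R)]
      nlinarith)
    simp [this]

lemma exists_cutoff (hM : ∀ p, 0 < M p) (hlog : ∀ p q, M p * M q ≤ M 0 * M (p + q))
    {φ : ℝ → ℂ} (hφ : IsTestD1 M φ) (hne : φ ≠ 0) :
    ∃ η : ℝ → ℂ, IsTestD1 M η ∧ (∀ x, |x| ≤ 1 → η x = 1) ∧ ∀ x, 2 ≤ |x| → η x = 0 := by
  obtain ⟨ψ, hψ, hψ1, hψ0⟩ := exists_mollifier hM hlog hφ hne
  have hcont : Continuous ψ := hψ.contDiff.continuous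
  let P : ℝ → ℂ := fun y => ∫ t in (0 : ℝ)..y, ψ t
  let η : ℝ → ℂ := fun x => P (x + 3 / 2) - P (x + -(3 / 2))
  have hη : ∀ x, η x = ∫ t in (x + -(3 / 2))..(x + 3 / 2), ψ t := fun x =>
    intervalIntegral.integral_interval_sub_left (hcont.intervalIntegrable _ _)
      (hcont.intervalIntegrable _ _)
  have h1 : ∀ x, |x| ≤ 1 → η x = 1 := fun x hx => by
    rw [hη, intervalIntegral.integral_eq_integral_of_support_subset, hψ1]
    intro t ht
    have := abs_lt.1 (lt_of_not_ge fun h => ht (hψ0 t h))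
    have := abs_le.1 hx
    constructor <;> linarith
  have h0 : ∀ x, 2 ≤ |x| → η x = 0 := fun x hx => by
    rw [hη, intervalIntegral.integral_congr (g := fun _ => 0), intervalIntegral.integral_zero]
    intro t ht
    rw [Set.uIcc_of_le (by linarith)] at ht
    refine hψ0 t ?_
    rcases le_abs'.1 hx with h | h
    · rw [le_abs']
      left
      linarith [ht.2]
    · rw [le_abs']
      right
      linarith [ht.1]
  refine ⟨η, ?_, h1, h0⟩
  refine IsTestD1.of_hasDerivAt hM (fun p => hlog p 1)
    ((hψ.comp_add hM (3 / 2)).sub hM (hψ.comp_add hM (-(3 / 2)))) (fun x => ?_)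
    (HasCompactSupport.intro (isCompact_Icc (a := -2) (b := 2)) fun x hx => h0 x ?_)
  · exact ((hcont.integral_hasStrictDerivAt 0 _).hasDerivAt.comp_add_const x (3 / 2)).sub
      ((hcont.integral_hasStrictDerivAt 0 _).hasDerivAt.comp_add_const x (-(3 / 2)))
  · by_contra h
    exact hx (abs_le.1 (not_le.1 h).le)

lemma isCompact_annulus (a b : ℝ) : IsCompact {x : ℝ | a ≤ |x| ∧ |x| ≤ b} :=
  (isCompact_Icc (a := -b) (b := b)).of_isClosed_subset
    ((isClosed_le continuous_const continuous_abs).inter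
      (isClosed_le continuous_abs continuous_const)) fun _ hx => abs_le.1 hx.2

end

section

variable {M : ℕ → ℝ} {K : Set ℝ}

/-- The functional `φ ↦ ⟨f(λx), φ(x)⟩`. -/
def dilate (f : (ℝ → ℂ) →ₗ[ℂ] ℂ) (lam : ℝ) : (ℝ → ℂ) →ₗ[ℂ] ℂ :=
  (lam : ℂ)⁻¹ • f.comp (LinearMap.funLeft ℂ ℂ fun x => x / lam)

lemma dilate_apply (f : (ℝ → ℂ) →ₗ[ℂ] ℂ) (lam : ℝ) (φ : ℝ → ℂ) :
    dilate f lam φ = (lam : ℂ)⁻¹ * f (fun x => φ (x / lam)) := rfl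

lemma IsUltraD1.dilate_bound (hM : ∀ p, 0 < M p) {f : (ℝ → ℂ) →ₗ[ℂ] ℂ} (hf : IsUltraD1 M f)
    (hK : IsCompact K) {lam : ℝ} (hlam : 0 < lam) :
    ∃ ℓ > (0 : ℝ), ∃ C > (0 : ℝ), ∀ φ : ℝ → ℂ, IsTestD1 M φ → tsupport φ ⊆ K →
      ∀ B, 0 ≤ B → DerivBound M ℓ B φ → ‖dilate f lam φ‖ ≤ C * B := by
  obtain ⟨ℓ, hℓ, C, hC, h⟩ := hf.bound hM (hK.image (continuous_const_mul lam))
  refine ⟨lam * ℓ, by positivity, lam⁻¹ * C, by positivity, fun φ hφ hs B hB hb => ?_⟩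
  rw [dilate_apply, norm_mul, norm_inv, Complex.norm_of_nonneg hlam.le, mul_assoc]
  have hc := hb.comp_mul hφ.contDiff lam⁻¹
  rw [abs_of_pos (inv_pos.2 hlam), inv_mul_cancel_left₀ hlam.ne'] at hc
  simp only [div_eq_inv_mul]
  refine mul_le_mul_of_nonneg_left (h _ (hφ.comp_mul hM (inv_ne_zero hlam.ne')) ?_ B hB hc)
    (by positivity)
  refine closure_minimal (fun x hx => ?_) (hK.image (continuous_const_mul lam)).isClosed
  exact ⟨lam⁻¹ * x, hs (subset_closure hx), mul_inv_cancel_left₀ hlam.ne' x⟩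

/-- Representation of `f` near `|x| ∼ λ`, with bounds that are uniform in `λ`. -/
lemma exists_repr_dilate (hM : ∀ p, 0 < M p) (hlog : ∀ p q, M p * M q ≤ M 0 * M (p + q))
    (h2 : IsM2' M) {f : (ℝ → ℂ) →ₗ[ℂ] ℂ} (hf : IsUltraD1 M f) {ρ : ℝ → ℝ} {lam0 : ℝ}
    (hρ : ∀ x ≥ lam0, 0 < ρ x) (hK : IsCompact K) (hK0 : (0 : ℝ) ∉ K)
    (hquasi : ∀ φ : ℝ → ℂ, IsTestD1 M φ → (0 : ℝ) ∉ tsupport φ →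
      ∃ C > (0 : ℝ), ∃ Λ > (0 : ℝ), ∀ lam : ℝ, Λ ≤ lam →
        ‖(lam : ℂ)⁻¹ * f (fun x => φ (x / lam))‖ ≤ C * ρ lam)
    {χ : ℝ → ℂ} (hχ : IsTestD1 M χ) (hχK : tsupport χ ⊆ K) :
    ∃ A : ℝ, 0 ≤ A ∧ ∃ s : ℝ, 0 < s ∧ ∃ Λ : ℝ, ∀ lam ≥ Λ,
      ∃ F : ℕ → ℝ → ℂ, (∀ n, Continuous (F n)) ∧
        (∀ n x, ‖F n x‖ ≤ A * (s ^ n / M n) * lam ^ n * ρ lam) ∧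
        (∀ n x, x / lam ∉ K → F n x = 0) ∧
        ∀ φ, IsTestD1 M φ → HasSum (fun n => (-1) ^ n * ∫ x, F n x * iteratedDeriv n φ x)
          (f (fun x => φ x * χ (x / lam))) := by
  obtain ⟨ℓ, hℓ, C, hC, Λ, hΛ, hT⟩ := exists_uniform_bound hM hK (dilate f) hρ
    (fun lam hlam => hf.dilate_bound hM hK hlam)
    (fun φ hφ hs => hquasi φ hφ fun h => hK0 (hs h))
  obtain ⟨A, hA, s, hs, h⟩ := exists_repr_mul hM hlog h2 hK hχ hχK hℓ
  refine ⟨C * A, by positivity, s, hs, max Λ lam0, fun lam hlam => ?_⟩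
  have hl0 : 0 < lam := hΛ.trans_le ((le_max_left _ _).trans hlam)
  have hρl := hρ lam ((le_max_right _ _).trans hlam)
  have hlC : (lam : ℂ) ≠ 0 := Complex.ofReal_ne_zero.2 hl0.ne'
  obtain ⟨g, hgc, hgb, hg0, hg⟩ := h (C * ρ lam) (dilate f lam) (by positivity)
    (hT lam ((le_max_left _ _).trans hlam))
  refine ⟨fun n x => (lam : ℂ) ^ n * g n (x / lam), fun n => continuous_const.mul
    ((hgc n).comp (continuous_id.div_const lam)), fun n x => ?_, fun n x hx => ?_, fun φ hφ => ?_⟩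
  · rw [norm_mul, norm_pow, Complex.norm_of_nonneg hl0.le]
    calc _ ≤ lam ^ n * (C * ρ lam * A * (s ^ n / M n)) := by
          gcongr
          exact hgb n _
      _ = _ := by ring
  · simp only [hg0 n _ hx, mul_zero]
  · have h1 := (hg _ (hφ.comp_mul hM hl0.ne')).mul_left (lam : ℂ)
    rw [dilate_apply, mul_inv_cancel_left₀ hlC] at h1
    refine Eq.mpr (congrArg₂ HasSum (funext fun n => ?_) (congrArg f (funext fun x => ?_))) h1
    · have hc := Measure.integral_comp_mul_left (fun x => g n (x / lam) * iteratedDeriv n φ x) lam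
      simp only [mul_div_cancel_left₀ _ hl0.ne', abs_of_pos (inv_pos.2 hl0)] at hc
      have he : ∀ x, g n x * iteratedDeriv n (fun x => φ (lam * x)) x =
          (lam : ℂ) ^ n * (g n x * iteratedDeriv n φ (lam * x)) := fun x => by
        rw [iteratedDeriv_comp_const_smul (hφ.contDiff_nat n)]
        simp only [Complex.real_smul]
        push_cast
        ring
      simp only [he, mul_assoc, integral_const_mul, hc, Complex.real_smul]
      push_cast
      field_simp
    · simp only [Pi.mul_apply, mul_div_cancel₀ x hl0.ne']

end

section

variable {M : ℕ → ℝ}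

/-- Dyadic shells `lam * 2 ^ j ≤ |x| ≤ 4 * (lam * 2 ^ j)` overlap at most three at a time. -/
lemma exists_forall_mem_Icc_of_shell {lam : ℝ} (hlam : 0 < lam) (x : ℝ) :
    ∃ i : ℕ, ∀ j, lam * 2 ^ j ≤ |x| → |x| ≤ 4 * (lam * 2 ^ j) → j ∈ Finset.Icc i (i + 2) := by
  classical
  by_cases h : ∃ i : ℕ, lam * 2 ^ i ≤ |x| ∧ |x| ≤ 4 * (lam * 2 ^ i)
  · refine ⟨Nat.find h, fun j hj hj' => Finset.mem_Icc.2 ⟨Nat.find_min' h ⟨hj, hj'⟩, ?_⟩⟩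
    have h1 : lam * 2 ^ j ≤ lam * 2 ^ (Nat.find h + 2) := by
      refine (hj.trans (Nat.find_spec h).2).trans_eq ?_
      rw [pow_add]
      ring
    exact (pow_le_pow_iff_right₀ one_lt_two).1 (le_of_mul_le_mul_left h1 hlam)
  · exact ⟨0, fun j hj hj' => (h ⟨j, hj, hj'⟩).elim⟩

section Shell

variable {lam : ℝ} {u : ℕ → ℝ → ℂ}

lemma tsum_shell_eq_sum (hlam : 0 < lam)
    (hu : ∀ j x, ¬ (lam * 2 ^ j ≤ |x| ∧ |x| ≤ 4 * (lam * 2 ^ j)) → u j x = 0) {J : ℕ} {x : ℝ}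
    (hx : |x| < lam * 2 ^ J) : ∑' j, u j x = ∑ j ∈ Finset.range J, u j x := by
  refine tsum_eq_sum fun j hj => hu j x fun h => ?_
  have h1 : lam * 2 ^ J ≤ lam * 2 ^ j := by
    gcongr
    · norm_num
    · simpa using hj
  linarith [h.1]

lemma exists_lt_mul_two_pow (hlam : 0 < lam) (x : ℝ) : ∃ J : ℕ, x < lam * 2 ^ J := by
  obtain ⟨J, hJ⟩ := pow_unbounded_of_one_lt (x / lam) one_lt_two
  exact ⟨J, by rwa [div_lt_iff₀' hlam] at hJ⟩

lemma continuous_tsum_shell (hlam : 0 < lam)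
    (hu : ∀ j x, ¬ (lam * 2 ^ j ≤ |x| ∧ |x| ≤ 4 * (lam * 2 ^ j)) → u j x = 0)
    (hc : ∀ j, Continuous (u j)) : Continuous fun x => ∑' j, u j x := by
  refine continuous_iff_continuousAt.2 fun x => ?_
  obtain ⟨J, hJ⟩ := exists_lt_mul_two_pow hlam |x|
  refine ContinuousAt.congr
    (continuous_finsetSum (Finset.range J) fun j _ => hc j).continuousAt ?_
  filter_upwards [continuous_abs.continuousAt.eventually (gt_mem_nhds hJ)] with y hy
  exact (tsum_shell_eq_sum hlam hu hy).symm

lemma norm_tsum_shell_le (hlam : 0 < lam)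
    (hu : ∀ j x, ¬ (lam * 2 ^ j ≤ |x| ∧ |x| ≤ 4 * (lam * 2 ^ j)) → u j x = 0) {x D : ℝ}
    (hD : ∀ j, ‖u j x‖ ≤ D) : ‖∑' j, u j x‖ ≤ 3 * D := by
  obtain ⟨i, hi⟩ := exists_forall_mem_Icc_of_shell hlam x
  rw [tsum_eq_sum (s := Finset.Icc i (i + 2)) fun j hj => hu j x fun h => hj (hi j h.1 h.2)]
  refine (norm_sum_le_of_le _ fun j _ => hD j).trans_eq ?_
  rw [Finset.sum_const, Nat.card_Icc, nsmul_eq_mul]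
  congr 1
  rw [show i + 2 + 1 - i = 3 by omega]
  norm_num

end Shell

lemma exists_repr_of_ne_zero (hM1 : IsM1 M) (hM2' : IsM2' M)
    {f : (ℝ → ℂ) →ₗ[ℂ] ℂ} (hf : IsUltraD1 M f)
    {ρ : ℝ → ℝ} {lam0 : ℝ} (hρpos : ∀ x ≥ lam0, 0 < ρ x) (hρreg : IsORegVar ρ)
    (hquasi : ∀ φ : ℝ → ℂ, IsTestD1 M φ → (0 : ℝ) ∉ tsupport φ →
      ∃ C > (0 : ℝ), ∃ Λ > (0 : ℝ), ∀ lam : ℝ, Λ ≤ lam →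
        ‖(lam : ℂ)⁻¹ * f (fun x => φ (x / lam))‖ ≤ C * ρ lam)
    {φ₀ : ℝ → ℂ} (hφ₀ : IsTestD1 M φ₀) (hne : φ₀ ≠ 0) :
    ∃ x₀ > (0 : ℝ), ∃ F : ℕ → ℝ → ℂ, (∀ m, Continuous (F m)) ∧
      ∃ ℓ > (0 : ℝ), ∃ C > (0 : ℝ),
        (∀ (m : ℕ) (x : ℝ), x₀ < |x| → ‖F m x‖ ≤ C * (ℓ ^ m / M m) * |x| ^ m * ρ |x|) ∧
        ∀ φ : ℝ → ℂ, IsTestD1 M φ → tsupport φ ∩ Set.Icc (-x₀) x₀ = ∅ →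
          HasSum (fun m : ℕ => (-1 : ℂ) ^ m * ∫ x, F m x * iteratedDeriv m φ x) (f φ) := by
  have hM := hM1.1
  have hlog := hM1.mul_le
  obtain ⟨η, hη, hη1, hη0⟩ := exists_cutoff hM hlog hφ₀ hne
  let χ : ℝ → ℂ := fun x => η (2⁻¹ * x) - η x
  have hχ : IsTestD1 M χ := (hη.comp_mul hM (by norm_num)).sub hM hη
  have hK := isCompact_annulus 1 4
  have hχK : tsupport χ ⊆ {x : ℝ | 1 ≤ |x| ∧ |x| ≤ 4} := by
    refine closure_minimal (fun x hx => ?_) hK.isClosed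
    by_contra h
    refine hx ?_
    have h2 : |2⁻¹ * x| = 2⁻¹ * |x| := by rw [abs_mul, abs_of_pos (by norm_num)]
    by_cases h1 : 1 ≤ |x|
    · have h4 : 4 < |x| := not_le.1 fun h4 => h ⟨h1, h4⟩
      simp only [χ]
      rw [hη0 x (by linarith), hη0 _ (by rw [h2]; linarith), sub_zero]
    · have h1 := not_le.1 h1
      simp only [χ]
      rw [hη1 x h1.le, hη1 _ (by rw [h2]; linarith [abs_nonneg x]), sub_self]
  obtain ⟨A, hA, s, hs, Λ, hF⟩ := exists_repr_dilate hM hlog hM2' hf hρpos hK (by simp) hquasi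
    hχ hχK
  obtain ⟨D, hD, X, hX, hreg⟩ := hρreg 4 (by norm_num)
  set lam : ℝ := max (max Λ lam0) X with hlam_def
  have hlam : 0 < lam := hX.trans_le (le_max_right _ _)
  have hlamj : ∀ j : ℕ, lam ≤ lam * 2 ^ j := fun j =>
    le_mul_of_one_le_right hlam.le (one_le_pow₀ one_le_two)
  choose F hFc hFb hF0 hFs using fun j : ℕ => hF (lam * 2 ^ j)
    (((le_max_left _ _).trans (le_max_left _ _)).trans (hlamj j))
  have hF0' : ∀ n j x, ¬ (lam * 2 ^ j ≤ |x| ∧ |x| ≤ 4 * (lam * 2 ^ j)) → F j n x = 0 := by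
    intro n j x h
    refine hF0 j n x fun h' => h ?_
    have hp : 0 < lam * 2 ^ j := by positivity
    rw [Set.mem_ofPred_eq, abs_div, abs_of_pos hp, le_div_iff₀ hp, div_le_iff₀ hp, one_mul] at h'
    exact h'
  have hFb' : ∀ n j x, lam < |x| →
      ‖F j n x‖ ≤ (A + 1) * D * (s ^ n / M n) * |x| ^ n * ρ |x| := by
    intro n j x hx
    have hMn := hM n
    have hρx : 0 < ρ |x| := hρpos _ (((le_max_right _ _).trans (le_max_left _ _)).trans hx.le)
    by_cases h : lam * 2 ^ j ≤ |x| ∧ |x| ≤ 4 * (lam * 2 ^ j)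
    · have hx0 : 0 < |x| := hlam.trans hx
      have hρj : ρ (lam * 2 ^ j) ≤ D * ρ |x| := by
        have := hreg |x| ((le_max_right _ _).trans hx.le) (lam * 2 ^ j / |x|)
          ⟨by rw [div_le_div_iff₀ (by norm_num) hx0]; linarith,
            by rw [div_le_iff₀ hx0]; linarith⟩
        rwa [div_mul_cancel₀ _ hx0.ne'] at this
      calc _ ≤ A * (s ^ n / M n) * (lam * 2 ^ j) ^ n * ρ (lam * 2 ^ j) := hFb j n x
        _ ≤ (A + 1) * (s ^ n / M n) * |x| ^ n * (D * ρ |x|) := by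
          have := hρpos (lam * 2 ^ j)
            (((le_max_right _ _).trans (le_max_left _ _)).trans (hlamj j))
          gcongr
          · linarith
          · exact h.1
        _ = _ := by ring
    · rw [hF0' n j x h, norm_zero]
      positivity
  refine ⟨2 * lam, by positivity, fun n x => ∑' j, F j n x,
    fun n => continuous_tsum_shell hlam (hF0' n) fun j => hFc j n, s, hs, 3 * ((A + 1) * D),
    by positivity, fun n x hx => ?_, fun φ hφ hφs => ?_⟩
  · refine (norm_tsum_shell_le hlam (hF0' n)
      fun j => hFb' n j x (by linarith)).trans_eq ?_
    ring
  · obtain ⟨R, hR, hRφ⟩ := hφ.hasCompactSupport.isCompact.isBounded.exists_pos_norm_lt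
    obtain ⟨J, hJ⟩ := exists_lt_mul_two_pow hlam R
    have hint : ∀ n j, Integrable fun x => F j n x * iteratedDeriv n φ x := fun n j =>
      ((hFc j n).mul (hφ.continuous_iteratedDeriv n)).integrable_of_hasCompactSupport
        (hφ.hasCompactSupport_iteratedDeriv n).mul_left
    have hsum := hasSum_sum (s := Finset.range J) fun j _ => hFs j φ hφ
    refine Eq.mpr (congrArg₂ HasSum (funext fun n => ?_) ?_) hsum
    · rw [← Finset.mul_sum, ← integral_finsetSum _ fun j _ => hint n j]
      congr 2
      funext x
      by_cases hx : x ∈ tsupport φ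
      · beta_reduce
        rw [tsum_shell_eq_sum hlam (hF0' n) ((hRφ x hx).trans hJ), Finset.sum_mul]
      · simp only [iteratedDeriv_eq_zero_of_notMem_tsupport hx n, mul_zero,
          Finset.sum_const_zero]
    · rw [← map_sum]
      congr 1
      funext x
      rw [Finset.sum_apply, ← Finset.mul_sum]
      by_cases hx : x ∈ tsupport φ
      · have htel : ∀ j ∈ Finset.range J, χ (x / (lam * 2 ^ j)) =
            η (x / (lam * 2 ^ (j + 1))) - η (x / (lam * 2 ^ j)) := fun j _ => by
          simp only [χ]
          congr 2
          rw [pow_succ]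
          field_simp
        have hx2 : 2 * lam < |x| := by
          by_contra h
          exact Set.notMem_empty x (hφs ▸ ⟨hx, abs_le.1 (not_lt.1 h)⟩)
        rw [Finset.sum_congr rfl htel, Finset.sum_range_sub (fun j => η (x / (lam * 2 ^ j))),
          hη1 (x / (lam * 2 ^ J)), hη0 (x / (lam * 2 ^ 0)), sub_zero, mul_one]
        · rw [pow_zero, mul_one, abs_div, abs_of_pos hlam, le_div_iff₀ hlam]
          exact hx2.le
        · rw [abs_div, abs_of_pos (by positivity : 0 < lam * 2 ^ J), div_le_one (by positivity)]
          exact ((hRφ x hx).trans hJ).le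
      · rw [image_eq_zero_of_notMem_tsupport hx, zero_mul]

end

/-- structure of quasiasymptotically bounded ultradistributions away
from the origin. -/
theorem stmt11 (M : ℕ → ℝ) (hM1 : IsM1 M) (hM2' : IsM2' M) (hM3' : IsM3' M)
    (f : (ℝ → ℂ) →ₗ[ℂ] ℂ) (hf : IsUltraD1 M f)
    (ρ : ℝ → ℝ) (lam0 : ℝ) (hρpos : ∀ x ≥ lam0, 0 < ρ x) (hρmeas : Measurable ρ)
    (hρreg : IsORegVar ρ)
    (hquasi : ∀ φ : ℝ → ℂ, IsTestD1 M φ → (0 : ℝ) ∉ tsupport φ →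
      ∃ C > (0 : ℝ), ∃ Λ > (0 : ℝ), ∀ lam : ℝ, Λ ≤ lam →
        ‖(lam : ℂ)⁻¹ * f (fun x => φ (x / lam))‖ ≤ C * ρ lam) :
    ∃ x₀ > (0 : ℝ), ∃ F : ℕ → ℝ → ℂ,
      (∀ m, ContinuousOn (F m) {x : ℝ | x₀ < |x|}) ∧
      ∃ ℓ > (0 : ℝ), ∃ C > (0 : ℝ),
        (∀ (m : ℕ) (x : ℝ), x₀ < |x| →
          ‖F m x‖ ≤ C * (ℓ ^ m / M m) * |x| ^ m * ρ |x|) ∧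
        ∀ φ : ℝ → ℂ, IsTestD1 M φ → tsupport φ ∩ Set.Icc (-x₀) x₀ = ∅ →
          (∀ m : ℕ, IntegrableOn (fun x => F m x * iteratedDeriv m φ x) {x : ℝ | x₀ < |x|}) ∧
          Summable (fun m : ℕ =>
            ‖∫ x in {x : ℝ | x₀ < |x|}, F m x * iteratedDeriv m φ x‖) ∧
          f φ = ∑' m : ℕ,
            (-1 : ℂ) ^ m * ∫ x in {x : ℝ | x₀ < |x|}, F m x * iteratedDeriv m φ x := by
  by_cases h : ∃ φ₀, IsTestD1 M φ₀ ∧ φ₀ ≠ 0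
  · obtain ⟨φ₀, hφ₀, hne⟩ := h
    obtain ⟨x₀, hx₀, F, hFc, ℓ, hℓ, C, hC, hFb, hFs⟩ :=
      exists_repr_of_ne_zero hM1 hM2' hf hρpos hρreg hquasi hφ₀ hne
    refine ⟨x₀, hx₀, F, fun m => (hFc m).continuousOn, ℓ, hℓ, C, hC, hFb, fun φ hφ hφs => ?_⟩
    have hint : ∀ m, ∫ x in {x : ℝ | x₀ < |x|}, F m x * iteratedDeriv m φ x =
        ∫ x, F m x * iteratedDeriv m φ x := fun m => by
      refine setIntegral_eq_integral_of_forall_compl_eq_zero fun x hx => ?_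
      have hx' : x ∉ tsupport φ := fun hxφ =>
        Set.notMem_empty x (hφs ▸ ⟨hxφ, abs_le.1 (not_lt.1 hx)⟩)
      rw [iteratedDeriv_eq_zero_of_notMem_tsupport hx' m, mul_zero]
    have hs := hFs φ hφ hφs
    simp only [hint]
    refine ⟨fun m => (((hFc m).mul
      (hφ.continuous_iteratedDeriv m)).integrable_of_hasCompactSupport
        (hφ.hasCompactSupport_iteratedDeriv m).mul_left).integrableOn, ?_, hs.tsum_eq.symm⟩
    simpa only [norm_mul, norm_pow, norm_neg, norm_one, one_pow, one_mul] using hs.summable.norm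
  · refine ⟨max lam0 1, by positivity, fun _ _ => 0, fun _ => continuousOn_const, 1, one_pos, 1,
      one_pos, fun m x hx => ?_, fun φ hφ _ => ?_⟩
    · have hMm := hM1.1 m
      have hρx := hρpos |x| ((le_max_left _ _).trans hx.le)
      rw [norm_zero]
      positivity
    · obtain rfl : φ = 0 := by_contra fun hne => h ⟨φ, hφ, hne⟩
      simp
end
end

section
/- Let M_p be a weight sequence satisfying (M.1). Then every f ∈ K'^{(M_p)}(ℝ^d) satisfies the moment asymptotic expansion in K'^{(M_p)}(ℝ^d) with moments μ_α := ⟨f, x ↦ x^α⟩ (note that every polynomial belongs to K^{(M_p)}(ℝ^d)): for every φ ∈ K^{(M_p)}(ℝ^d) and every k ∈ ℕ, λ^{−d}⟨f, φ(·/λ)⟩ = Σ_{|α|<k} μ_α ∂^αφ(0)/(α! λ^{|α|+d}) + O(λ^{−k−d}) as λ → ∞. -/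
open MeasureTheory Real
open scoped BigOperators Pointwise

noncomputable section

/-- `ℝ^d` with the Euclidean norm. -/
abbrev Rd (d : ℕ) := EuclideanSpace ℝ (Fin d)

variable {d : ℕ}

/-- The partial derivative in the `i`-th coordinate direction. -/
def pder (i : Fin d) (f : Rd d → ℂ) : Rd d → ℂ :=
  fun x => fderiv ℝ f x (EuclideanSpace.single i 1)

/-- The multi-index partial derivative `∂^α`. -/
def mderiv (α : Fin d → ℕ) (f : Rd d → ℂ) : Rd d → ℂ :=
  (List.finRange d).foldr (fun i g => (pder i)^[α i] g) f

/-- The order `|α|` of a multi-index. -/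
def mOrd (α : Fin d → ℕ) : ℕ := ∑ i, α i

/-- The factorial `α!` of a multi-index. -/
def mFact (α : Fin d → ℕ) : ℕ := ∏ i, Nat.factorial (α i)

/-- The set of quotients defining the norm of `E^{M_p,ℓ}(K)`. -/
def ESet (M : ℕ → ℝ) (ℓ : ℝ) (K : Set (Rd d)) (φ : Rd d → ℂ) : Set ℝ :=
  {r | ∃ (α : Fin d → ℕ) (x : Rd d), x ∈ K ∧
    r = ‖mderiv α φ x‖ / (ℓ ^ mOrd α * M (mOrd α))}

/-- `‖φ‖_{E^{M_p,ℓ}(K)}`. -/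
def Enorm (M : ℕ → ℝ) (ℓ : ℝ) (K : Set (Rd d)) (φ : Rd d → ℂ) : ℝ :=
  sSup (ESet M ℓ K φ)

/-- Finiteness of `‖φ‖_{E^{M_p,ℓ}(K)}`. -/
def EnormFin (M : ℕ → ℝ) (ℓ : ℝ) (K : Set (Rd d)) (φ : Rd d → ℂ) : Prop :=
  BddAbove (ESet M ℓ K φ)

/-- Membership in the test space `D^{(M_p)}(ℝ^d)`. -/
def IsTestD (M : ℕ → ℝ) (φ : Rd d → ℂ) : Prop :=
  ContDiff ℝ (⊤ : ℕ∞) φ ∧ HasCompactSupport φ ∧ ∀ ℓ > (0 : ℝ), EnormFin M ℓ (tsupport φ) φ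

/-- `f` is a Beurling ultradistribution of class `(M_p)`. -/
def IsUltraD (M : ℕ → ℝ) (f : (Rd d → ℂ) →ₗ[ℂ] ℂ) : Prop :=
  ∀ K : Set (Rd d), IsCompact K → ∃ ℓ > (0 : ℝ), ∃ C > (0 : ℝ), ∀ φ : Rd d → ℂ,
    IsTestD M φ → tsupport φ ⊆ K → ‖f φ‖ ≤ C * Enorm M ℓ K φ

/-- Euclidean dot product. -/
def dotR (ξ t : Rd d) : ℝ := ∑ i, ξ i * t i

/-- The window `t ↦ conj(ψ(t-x)) e^{-2πi ξ·t}` of the short-time Fourier transform. -/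
def windowFn (ψ : Rd d → ℂ) (x ξ : Rd d) : Rd d → ℂ :=
  fun t => (starRingEnd ℂ) (ψ (t - x)) * Complex.exp (-(2 * Real.pi * dotR ξ t : ℝ) * Complex.I)

/-- The short-time Fourier transform of a function `φ` with respect to the window `ψ`. -/
def STFTf (ψ φ : Rd d → ℂ) (x ξ : Rd d) : ℂ := ∫ t, φ t * windowFn ψ x ξ t

/-- The short-time Fourier transform of a linear functional `f` w.r.t. the window `ψ`. -/
def STFTd (f : (Rd d → ℂ) →ₗ[ℂ] ℂ) (ψ : Rd d → ℂ) (x ξ : Rd d) : ℂ := f (windowFn ψ x ξ)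

/-- The weight condition (5): `ω(·+x)/ω(x)` locally uniformly bounded. -/
def OmegaCond (ω : Rd d → ℝ) : Prop :=
  (∀ x, 0 < ω x) ∧ Measurable ω ∧
    ∀ R > (0 : ℝ), ∃ C > (0 : ℝ), ∀ x h : Rd d, ‖h‖ ≤ R → ω (x + h) ≤ C * ω x

/-- The set of values defining the norm `‖φ‖_{K^{M_p,ℓ}_q}`. -/
def KSet (M : ℕ → ℝ) {d : ℕ} (q : ℕ) (ℓ : ℝ) (φ : Rd d → ℂ) : Set ℝ :=
  {r | ∃ (α : Fin d → ℕ) (x : Rd d),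
    r = (1 + ‖x‖) ^ ((mOrd α : ℤ) - q) * ‖mderiv α φ x‖ / (ℓ ^ mOrd α * M (mOrd α))}

/-- `‖φ‖_{K^{M_p,ℓ}_q}`. -/
def Knorm (M : ℕ → ℝ) {d : ℕ} (q : ℕ) (ℓ : ℝ) (φ : Rd d → ℂ) : ℝ := sSup (KSet M q ℓ φ)

/-- Finiteness of `‖φ‖_{K^{M_p,ℓ}_q}`. -/
def KnormFin (M : ℕ → ℝ) {d : ℕ} (q : ℕ) (ℓ : ℝ) (φ : Rd d → ℂ) : Prop :=
  BddAbove (KSet M q ℓ φ)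

/-- Membership in `K^{(M_p)}(ℝ^d)`. -/
def IsKTest (M : ℕ → ℝ) {d : ℕ} (φ : Rd d → ℂ) : Prop :=
  ContDiff ℝ (⊤ : ℕ∞) φ ∧ ∃ q : ℕ, ∀ ℓ > (0 : ℝ), KnormFin M q ℓ φ

/-- Membership in the dual space `K'^{(M_p)}(ℝ^d)`. -/
def IsKDual (M : ℕ → ℝ) {d : ℕ} (f : (Rd d → ℂ) →ₗ[ℂ] ℂ) : Prop :=
  ∀ q : ℕ, ∃ ℓ > (0 : ℝ), ∃ C > (0 : ℝ), ∀ φ : Rd d → ℂ, ContDiff ℝ (⊤ : ℕ∞) φ →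
    (∀ ℓ' > (0 : ℝ), KnormFin M q ℓ' φ) → ‖f φ‖ ≤ C * Knorm M q ℓ φ

/-- The finite set of multi-indices of order `< k`. -/
def momIdx (d k : ℕ) : Finset (Fin d → ℕ) :=
  (Fintype.piFinset fun _ : Fin d => Finset.range k).filter fun α => mOrd α < k

/-- The monomial `x ↦ x^α`. -/
def monomial {d : ℕ} (α : Fin d → ℕ) : Rd d → ℂ := fun x => ∏ i, (x i : ℂ) ^ α i

lemma contDiff_pder (i : Fin d) {f : Rd d → ℂ} (hf : ContDiff ℝ (⊤ : ℕ∞) f) :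
    ContDiff ℝ (⊤ : ℕ∞) (pder i f) :=
  (hf.fderiv_right (m := (⊤ : ℕ∞)) (by simp)).clm_apply contDiff_const

lemma contDiff_pder_iterate (i : Fin d) {f : Rd d → ℂ} (hf : ContDiff ℝ (⊤ : ℕ∞) f) (n : ℕ) :
    ContDiff ℝ (⊤ : ℕ∞) ((pder i)^[n] f) := by
  induction n with
  | zero => exact hf
  | succ n ih => rw [Function.iterate_succ_apply']; exact contDiff_pder i ih

lemma contDiff_foldr_pder (α : Fin d → ℕ) {f : Rd d → ℂ} (hf : ContDiff ℝ (⊤ : ℕ∞) f)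
    (l : List (Fin d)) :
    ContDiff ℝ (⊤ : ℕ∞) (l.foldr (fun i g => (pder i)^[α i] g) f) := by
  induction l with
  | nil => exact hf
  | cons i l ih => exact contDiff_pder_iterate i ih _

lemma contDiff_mderiv (α : Fin d → ℕ) {f : Rd d → ℂ} (hf : ContDiff ℝ (⊤ : ℕ∞) f) :
    ContDiff ℝ (⊤ : ℕ∞) (mderiv α f) :=
  contDiff_foldr_pder α hf _

lemma pder_comm (i j : Fin d) {f : Rd d → ℂ} (hf : ContDiff ℝ (⊤ : ℕ∞) f) :
    pder i (pder j f) = pder j (pder i f) := by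
  have key : ∀ (a b : Fin d) (x : Rd d), pder a (pder b f) x =
      fderiv ℝ (fderiv ℝ f) x (EuclideanSpace.single a 1) (EuclideanSpace.single b 1) := by
    intro a b x
    have h : DifferentiableAt ℝ (fderiv ℝ f) x :=
      (hf.fderiv_right (m := (⊤ : ℕ∞)) (by simp)).differentiable (by simp) x
    change fderiv ℝ (fun y => fderiv ℝ f y (EuclideanSpace.single b 1)) x
      (EuclideanSpace.single a 1) = _
    rw [fderiv_clm_apply h (differentiableAt_const _)]
    simp
  funext x
  rw [key, key]
  exact (hf.contDiffAt.isSymmSndFDerivAt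
    (by rw [minSmoothness_of_isRCLikeNormedField]; exact WithTop.coe_le_coe.mpr (le_top : (2 : ℕ∞) ≤ ⊤))).eq _ _

lemma pder_iterate_comm (i j : Fin d) {f : Rd d → ℂ} (hf : ContDiff ℝ (⊤ : ℕ∞) f) (n : ℕ) :
    (pder j)^[n] (pder i f) = pder i ((pder j)^[n] f) := by
  induction n with
  | zero => rfl
  | succ n ih =>
    rw [Function.iterate_succ_apply', ih, Function.iterate_succ_apply',
      pder_comm j i (contDiff_pder_iterate j hf n)]

lemma mderiv_zero (f : Rd d → ℂ) : mderiv 0 f = f := by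
  unfold mderiv
  induction List.finRange d with
  | nil => rfl
  | cons i l ih => exact ih

lemma mderiv_add_single (α : Fin d → ℕ) (i : Fin d) {f : Rd d → ℂ}
    (hf : ContDiff ℝ (⊤ : ℕ∞) f) :
    mderiv (α + Pi.single i 1) f = pder i (mderiv α f) := by
  have key : ∀ l : List (Fin d), l.Nodup →
      l.foldr (fun j g => (pder j)^[(α + Pi.single i 1 : Fin d → ℕ) j] g) f =
        if i ∈ l then pder i (l.foldr (fun j g => (pder j)^[α j] g) f)
        else l.foldr (fun j g => (pder j)^[α j] g) f := by
    intro l hl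
    induction l with
    | nil => simp
    | cons j l ih =>
      obtain ⟨hj, hl⟩ := List.nodup_cons.mp hl
      simp only [List.foldr_cons, ih hl]
      by_cases hij : i = j
      · subst hij
        simp [hj, Function.iterate_succ_apply']
      · have hc := pder_iterate_comm i j (contDiff_foldr_pder α hf l) (α j)
        by_cases hi : i ∈ l <;> simp [hi, hij, Ne.symm hij, hc]
  unfold mderiv
  rw [key _ (List.nodup_finRange d)]
  simp

lemma mOrd_add_single (α : Fin d → ℕ) (i : Fin d) : mOrd (α + Pi.single i 1) = mOrd α + 1 := by
  simp [mOrd, Finset.sum_add_distrib]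

lemma multiIndex_induction {P : (Fin d → ℕ) → Prop} (zero : P 0)
    (add_single : ∀ α i, P α → P (α + Pi.single i 1)) (α : Fin d → ℕ) : P α := by
  induction hn : mOrd α generalizing α with
  | zero =>
    have : α = 0 := by
      funext i
      simpa using (Finset.sum_eq_zero_iff.mp hn) i (Finset.mem_univ i)
    exact this ▸ zero
  | succ n ih =>
    obtain ⟨i, hi⟩ : ∃ i, α i ≠ 0 := by
      by_contra! h
      simp [mOrd, h] at hn
    have hα : α - Pi.single i 1 + Pi.single i 1 = α := by
      funext j
      by_cases hj : j = i
      · subst hj; simp; omega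
      · simp [hj]
    rw [← hα]
    refine add_single _ i (ih _ ?_)
    rw [← hα, mOrd_add_single] at hn
    omega

lemma mderiv_sub {f g : Rd d → ℂ} (hf : ContDiff ℝ (⊤ : ℕ∞) f) (hg : ContDiff ℝ (⊤ : ℕ∞) g)
    (α : Fin d → ℕ) : mderiv α (f - g) = mderiv α f - mderiv α g := by
  have hfg : ContDiff ℝ (⊤ : ℕ∞) (f - g) := hf.sub hg
  induction α using multiIndex_induction with
  | zero => simp only [mderiv_zero]
  | add_single α i ih =>
    rw [mderiv_add_single α i hf, mderiv_add_single α i hg, mderiv_add_single α i hfg, ih]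
    funext x
    simp only [pder, Pi.sub_apply]
    rw [fderiv_sub ((contDiff_mderiv α hf).differentiable (by simp) x)
      ((contDiff_mderiv α hg).differentiable (by simp) x)]
    rfl

lemma mderiv_sum {ι : Type*} (s : Finset ι) (c : ι → ℂ) {g : ι → Rd d → ℂ}
    (hg : ∀ j, ContDiff ℝ (⊤ : ℕ∞) (g j)) (α : Fin d → ℕ) :
    mderiv α (∑ j ∈ s, c j • g j) = ∑ j ∈ s, c j • mderiv α (g j) := by
  have hs : ContDiff ℝ (⊤ : ℕ∞) (∑ j ∈ s, c j • g j) := by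
    rw [show (∑ j ∈ s, c j • g j) = fun x => ∑ j ∈ s, (c j • g j) x by
      funext x; rw [Finset.sum_apply]]
    exact ContDiff.sum fun j _ => (hg j).const_smul (c j)
  induction α using multiIndex_induction with
  | zero => simp only [mderiv_zero]
  | add_single α i ih =>
    rw [mderiv_add_single α i hs, ih]
    funext x
    have hd : ∀ j, DifferentiableAt ℝ (mderiv α (g j)) x := fun j =>
      (contDiff_mderiv α (hg j)).differentiable (by simp) x
    simp only [pder]
    rw [fderiv_sum fun j _ => (hd j).const_smul (c j)]
    simp only [_root_.sum_apply, Finset.sum_apply, Pi.smul_apply]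
    refine Finset.sum_congr rfl fun j _ => ?_
    rw [fderiv_const_smul (hd j), mderiv_add_single α i (hg j)]
    rfl

lemma mderiv_comp_smul {f : Rd d → ℂ} (hf : ContDiff ℝ (⊤ : ℕ∞) f) (c : ℝ) (α : Fin d → ℕ) :
    mderiv α (fun x => f (c • x)) = fun x => ((c : ℂ) ^ mOrd α) * mderiv α f (c • x) := by
  have hc : ContDiff ℝ (⊤ : ℕ∞) (fun x : Rd d => f (c • x)) :=
    hf.comp (contDiff_const_smul c)
  induction α using multiIndex_induction with
  | zero => simp [mderiv_zero, mOrd]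
  | add_single α i ih =>
    rw [mderiv_add_single α i hc, ih, mderiv_add_single α i hf, mOrd_add_single]
    funext x
    have hd : DifferentiableAt ℝ (fun x : Rd d => mderiv α f (c • x)) x :=
      ((contDiff_mderiv α hf).comp (contDiff_const_smul c)).differentiable (by simp) x
    simp only [pder]
    rw [fderiv_const_mul hd, fderiv_comp_smul]
    simp only [_root_.smul_apply, smul_eq_mul, Complex.real_smul]
    ring

lemma contDiff_monomial (β : Fin d → ℕ) : ContDiff ℝ (⊤ : ℕ∞) (monomial β) := by
  unfold monomial
  refine contDiff_prod fun i _ => ContDiff.pow ?_ _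
  exact Complex.ofRealCLM.contDiff.comp (EuclideanSpace.proj (𝕜 := ℝ) i).contDiff

lemma pder_monomial (i : Fin d) (β : Fin d → ℕ) :
    pder i (monomial β) = (β i : ℂ) • monomial (β - Pi.single i 1) := by
  funext x
  have hc : ∀ j, HasFDerivAt (fun y : Rd d => (y j : ℂ))
      (Complex.ofRealCLM ∘L EuclideanSpace.proj (𝕜 := ℝ) j) x := fun j =>
    (Complex.ofRealCLM ∘L EuclideanSpace.proj (𝕜 := ℝ) j).hasFDerivAt
  have h := HasFDerivAt.finsetProd (u := Finset.univ) fun j _ => (hc j).pow (β j)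
  simp only [pder]
  rw [show monomial β = fun y : Rd d => ∏ j, (y j : ℂ) ^ β j from rfl, h.fderiv]
  simp only [_root_.sum_apply, _root_.smul_apply]
  rw [Finset.sum_eq_single i]
  · simp only [monomial, Pi.smul_apply, smul_eq_mul, ContinuousLinearMap.comp_apply]
    have hprod : ∏ j, (x j : ℂ) ^ ((β - Pi.single i 1 : Fin d → ℕ) j) =
        (x i : ℂ) ^ (β i - 1) * ∏ j ∈ Finset.univ.erase i, (x j : ℂ) ^ β j := by
      refine (Finset.mul_prod_erase Finset.univ _ (Finset.mem_univ i)).symm.trans ?_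
      congr 1
      · simp
      · exact Finset.prod_congr rfl fun j hj => by simp [Finset.ne_of_mem_erase hj]
    rw [hprod]
    simp
    ring
  · intro j _ hj
    simp [hj]
  · simp

lemma mderiv_monomial (α β : Fin d → ℕ) :
    mderiv α (monomial β) =
      ((∏ i, (β i).descFactorial (α i) : ℕ) : ℂ) • monomial (β - α) := by
  induction α using multiIndex_induction with
  | zero => simp [mderiv_zero]
  | add_single α i ih =>
    rw [mderiv_add_single α i (contDiff_monomial β), ih]
    have hs : pder i (((∏ i, (β i).descFactorial (α i) : ℕ) : ℂ) • monomial (β - α)) =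
        ((∏ i, (β i).descFactorial (α i) : ℕ) : ℂ) • pder i (monomial (β - α)) := by
      funext x
      simp only [pder, Pi.smul_apply]
      rw [fderiv_const_smul ((contDiff_monomial _).differentiable (by simp) x)]
      rfl
    rw [hs, pder_monomial, smul_smul, tsub_tsub]
    congr 1
    norm_cast
    have hprod : ∏ j, (β j).descFactorial ((α + Pi.single i 1 : Fin d → ℕ) j) =
        (β i - α i) * (β i).descFactorial (α i) *
          ∏ j ∈ Finset.univ.erase i, (β j).descFactorial (α j) := by
      refine (Finset.mul_prod_erase Finset.univ _ (Finset.mem_univ i)).symm.trans ?_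
      congr 1
      · simp [Nat.descFactorial_succ]
      · exact Finset.prod_congr rfl fun j hj => by simp [Finset.ne_of_mem_erase hj]
    rw [hprod, ← Finset.mul_prod_erase Finset.univ _ (Finset.mem_univ i), Pi.sub_apply]
    ring

lemma mderiv_monomial_zero (α β : Fin d → ℕ) :
    mderiv α (monomial β) 0 = if α = β then (mFact α : ℂ) else 0 := by
  rw [mderiv_monomial]
  split_ifs with h
  · subst h
    simp [monomial, mFact, Nat.descFactorial_self]
  · obtain ⟨i, hi⟩ := Function.ne_iff.mp h
    rcases lt_or_gt_of_ne hi with hi | hi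
    · have : monomial (β - α) (0 : Rd d) = 0 :=
        Finset.prod_eq_zero (Finset.mem_univ i) (by simp; omega)
      simp [this]
    · have : ∏ i, (β i).descFactorial (α i) = 0 :=
        Finset.prod_eq_zero (Finset.mem_univ i) (Nat.descFactorial_eq_zero_iff_lt.mpr hi)
      simp [this]

lemma mderiv_monomial_of_mOrd_lt {α β : Fin d → ℕ} (h : mOrd β < mOrd α) :
    mderiv α (monomial β) = 0 := by
  obtain ⟨i, -, hi⟩ := Finset.exists_lt_of_sum_lt h
  have : ∏ i, (β i).descFactorial (α i) = 0 :=
    Finset.prod_eq_zero (Finset.mem_univ i) (Nat.descFactorial_eq_zero_iff_lt.mpr hi)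
  rw [mderiv_monomial, this]
  simp

lemma monomial_smul (α : Fin d → ℕ) (c : ℝ) (x : Rd d) :
    monomial α (c • x) = (c : ℂ) ^ mOrd α * monomial α x := by
  simp [monomial, mul_pow, Finset.prod_mul_distrib, Finset.prod_pow_eq_pow_sum, mOrd]

lemma mem_momIdx {k : ℕ} {α : Fin d → ℕ} : α ∈ momIdx d k ↔ mOrd α < k := by
  simp only [momIdx, Finset.mem_filter, Fintype.mem_piFinset, Finset.mem_range,
    and_iff_right_iff_imp]
  exact fun h i => (Finset.single_le_sum (fun _ _ => Nat.zero_le _) (Finset.mem_univ i)).trans_lt h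

/-- The Taylor polynomial of `φ` at the origin, of order less than `k`. -/
def taylorPoly (φ : Rd d → ℂ) (k : ℕ) : Rd d → ℂ :=
  ∑ α ∈ momIdx d k, (mderiv α φ 0 / mFact α) • monomial α

lemma contDiff_taylorPoly (φ : Rd d → ℂ) (k : ℕ) : ContDiff ℝ (⊤ : ℕ∞) (taylorPoly φ k) := by
  rw [show taylorPoly φ k = fun x => ∑ α ∈ momIdx d k,
    (mderiv α φ 0 / mFact α) • monomial α x by
      funext x; rw [taylorPoly, Finset.sum_apply]; rfl]
  exact ContDiff.sum fun α _ => (contDiff_monomial α).const_smul _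

lemma mderiv_taylorPoly_zero (φ : Rd d → ℂ) {k : ℕ} {α : Fin d → ℕ} (h : mOrd α < k) :
    mderiv α (taylorPoly φ k) 0 = mderiv α φ 0 := by
  have hα : (mFact α : ℂ) ≠ 0 := by
    simp [mFact, Finset.prod_ne_zero_iff, Nat.factorial_ne_zero]
  rw [taylorPoly, mderiv_sum _ _ contDiff_monomial]
  simp [mderiv_monomial_zero, mem_momIdx, h, hα]

lemma mderiv_taylorPoly_of_le (φ : Rd d → ℂ) {k : ℕ} {α : Fin d → ℕ} (h : k ≤ mOrd α) :
    mderiv α (taylorPoly φ k) = 0 := by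
  rw [taylorPoly, mderiv_sum _ _ contDiff_monomial]
  refine Finset.sum_eq_zero fun β hβ => ?_
  rw [mderiv_monomial_of_mOrd_lt ((mem_momIdx.mp hβ).trans_le h), smul_zero]

lemma norm_fderiv_le_sum_pder (f : Rd d → ℂ) (x : Rd d) :
    ‖fderiv ℝ f x‖ ≤ ∑ i, ‖pder i f x‖ := by
  refine ContinuousLinearMap.opNorm_le_bound _ (Finset.sum_nonneg fun _ _ => norm_nonneg _) ?_
  intro v
  have hv : ∑ i, v i • EuclideanSpace.single i (1 : ℝ) = v := by
    simpa using (EuclideanSpace.basisFun (Fin d) ℝ).sum_repr v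
  calc ‖fderiv ℝ f x v‖ = ‖∑ i, v i • pder i f x‖ := by
        conv_lhs => rw [← hv]
        simp [pder]
    _ ≤ ∑ i, ‖pder i f x‖ * ‖v‖ := norm_sum_le_of_le _ fun i _ => by
        rw [norm_smul, mul_comm]
        exact mul_le_mul_of_nonneg_left (PiLp.norm_apply_le v i) (norm_nonneg _)
    _ = _ := (Finset.sum_mul ..).symm

/-- A Taylor estimate: vanishing of the derivatives at `0` of order less than `k` propagates a bound
on the derivatives of order `k` to the lower ones. -/
lemma norm_mderiv_le_of_vanishing {g : Rd d → ℂ} (hg : ContDiff ℝ (⊤ : ℕ∞) g) {k m : ℕ} {B : ℝ}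
    (hB : 0 ≤ B) (h0 : ∀ α, mOrd α < k → mderiv α g 0 = 0)
    (hk : ∀ α, mOrd α = k → ∀ y, ‖mderiv α g y‖ ≤ B * (1 + ‖y‖) ^ m) (j : ℕ) :
    ∀ α, mOrd α + j = k → ∀ y, ‖mderiv α g y‖ ≤ B * d ^ j * ‖y‖ ^ j * (1 + ‖y‖) ^ m := by
  induction j with
  | zero => intro α hα y; simpa using hk α hα y
  | succ j ih =>
    intro α hα y
    have hbound : ∀ z ∈ Metric.closedBall (0 : Rd d) ‖y‖, ‖fderiv ℝ (mderiv α g) z‖ ≤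
        d * (B * d ^ j * ‖y‖ ^ j * (1 + ‖y‖) ^ m) := by
      intro z hz
      have hz : ‖z‖ ≤ ‖y‖ := by simpa using hz
      refine (norm_fderiv_le_sum_pder _ z).trans ?_
      refine (Finset.sum_le_card_nsmul _ _ (B * d ^ j * ‖y‖ ^ j * (1 + ‖y‖) ^ m) ?_).trans ?_
      · intro i _
        rw [← mderiv_add_single α i hg]
        refine (ih _ (by rw [mOrd_add_single]; omega) z).trans ?_
        gcongr
      · simp
    have := (convex_closedBall (0 : Rd d) ‖y‖).norm_image_sub_le_of_norm_fderiv_le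
      (fun z _ => (contDiff_mderiv α hg).differentiable (by simp) z) hbound
      (Metric.mem_closedBall_self (norm_nonneg y)) (y := y) (by simp)
    rw [h0 α (by omega), sub_zero, sub_zero] at this
    refine this.trans_eq ?_
    ring

lemma zpow_mul_pow_mul_zpow_le {k q a : ℕ} (hkq : k ≤ q) (hka : k ≤ a) {c t : ℝ} (hc : 0 < c)
    (hc1 : c ≤ 1) (ht : 0 ≤ t) :
    (1 + t) ^ ((a : ℤ) - q) * (c ^ a * (1 + c * t) ^ ((q : ℤ) - a)) ≤ c ^ k := by
  have h1 : 0 < 1 + t := by positivity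
  have h2 : 0 < 1 + c * t := by positivity
  rcases le_total a q with haq | hqa
  · obtain ⟨n, rfl⟩ := Nat.exists_eq_add_of_le haq
    have e1 : ((a : ℤ) - (a + n : ℕ)) = -(n : ℤ) := by push_cast; ring
    have e2 : (((a + n : ℕ) : ℤ) - a) = (n : ℤ) := by push_cast; ring
    rw [e1, e2, zpow_neg, zpow_natCast, zpow_natCast]
    have h3 : (1 + c * t) ^ n ≤ (1 + t) ^ n := by
      gcongr
      nlinarith
    have h4 : c ^ a ≤ c ^ k := pow_le_pow_of_le_one hc.le hc1 hka
    rw [inv_mul_le_iff₀ (by positivity), mul_comm ((1 + t) ^ n)]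
    exact mul_le_mul h4 h3 (by positivity) (by positivity)
  · obtain ⟨n, rfl⟩ := Nat.exists_eq_add_of_le hqa
    have e1 : (((q + n : ℕ) : ℤ) - q) = (n : ℤ) := by push_cast; ring
    have e2 : ((q : ℤ) - (q + n : ℕ)) = -(n : ℤ) := by push_cast; ring
    rw [e1, e2, zpow_neg, zpow_natCast, zpow_natCast]
    have h3 : (c * (1 + t)) ^ n ≤ (1 + c * t) ^ n := by
      gcongr
      nlinarith
    have h4 : c ^ q ≤ c ^ k := pow_le_pow_of_le_one hc.le hc1 hkq
    rw [← mul_assoc, ← div_eq_mul_inv, div_le_iff₀ (by positivity)]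
    calc (1 + t) ^ n * c ^ (q + n) = c ^ q * (c * (1 + t)) ^ n := by rw [mul_pow]; ring
      _ ≤ _ := mul_le_mul h4 h3 (by positivity) (by positivity)

lemma zpow_mul_pow_mul_pow_le {k q a : ℕ} (hkq : k ≤ q) (hak : a ≤ k) {c t : ℝ} (hc : 0 < c)
    (hc1 : c ≤ 1) (ht : 0 ≤ t) :
    (1 + t) ^ ((a : ℤ) - q) * (c ^ a * ((c * t) ^ (k - a) * (1 + c * t) ^ (q - k))) ≤ c ^ k := by
  obtain ⟨j, rfl⟩ := Nat.exists_eq_add_of_le hak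
  obtain ⟨m, rfl⟩ := Nat.exists_eq_add_of_le hkq
  have e : ((a : ℤ) - (a + j + m : ℕ)) = -((j + m : ℕ) : ℤ) := by push_cast; ring
  rw [e, zpow_neg, zpow_natCast, Nat.add_sub_cancel_left, Nat.add_sub_cancel_left,
    inv_mul_le_iff₀ (by positivity)]
  have h1 : t ^ j ≤ (1 + t) ^ j := by gcongr; linarith
  have h2 : (1 + c * t) ^ m ≤ (1 + t) ^ m := by
    gcongr
    nlinarith
  calc c ^ a * ((c * t) ^ j * (1 + c * t) ^ m) = c ^ (a + j) * (t ^ j * (1 + c * t) ^ m) := by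
        rw [mul_pow]; ring
    _ ≤ c ^ (a + j) * ((1 + t) ^ j * (1 + t) ^ m) := by gcongr
    _ = _ := by ring

lemma exists_bound_of_knormFin {M : ℕ → ℝ} (hM : ∀ p, 0 < M p) {q : ℕ} {ℓ : ℝ} (hℓ : 0 < ℓ)
    {φ : Rd d → ℂ} (h : KnormFin M q ℓ φ) :
    ∃ B ≥ (0 : ℝ), ∀ α y,
      ‖mderiv α φ y‖ ≤ B * (ℓ ^ mOrd α * M (mOrd α)) * (1 + ‖y‖) ^ ((q : ℤ) - mOrd α) := by
  obtain ⟨B, hB⟩ := h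
  refine ⟨max B 0, le_max_right _ _, fun α y => ?_⟩
  have h1 : 0 < 1 + ‖y‖ := by positivity
  have h2 : 0 < ℓ ^ mOrd α * M (mOrd α) := mul_pos (pow_pos hℓ _) (hM _)
  have h3 := (hB ⟨α, y, rfl⟩).trans (le_max_left B 0)
  rw [div_le_iff₀ h2, ← neg_sub (q : ℤ), zpow_neg, inv_mul_le_iff₀ (by positivity)] at h3
  linarith

lemma KnormFin.mono {M : ℕ → ℝ} (hM : ∀ p, 0 < M p) {q q' : ℕ} (hq : q ≤ q') {ℓ : ℝ}
    (hℓ : 0 < ℓ) {φ : Rd d → ℂ} (h : KnormFin M q ℓ φ) : KnormFin M q' ℓ φ := by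
  obtain ⟨B, hB⟩ := h
  refine ⟨B, ?_⟩
  rintro _ ⟨α, x, rfl⟩
  refine le_trans ?_ (hB ⟨α, x, rfl⟩)
  have h2 : 0 < ℓ ^ mOrd α * M (mOrd α) := mul_pos (pow_pos hℓ _) (hM _)
  have h1 : 1 ≤ 1 + ‖x‖ := by simp
  gcongr

/-- The rescaled Taylor remainder of order `k` is `O(c ^ k)` in every norm `‖·‖_{K^{M_p,ℓ}_q}`. -/
lemma exists_remainder_bound {M : ℕ → ℝ} (hM : ∀ p, 0 < M p) {k q : ℕ} (hkq : k ≤ q) {ℓ : ℝ}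
    (hℓ : 0 < ℓ) {φ : Rd d → ℂ} (hφ : ContDiff ℝ (⊤ : ℕ∞) φ) (h : KnormFin M q ℓ φ) :
    ∃ D ≥ (0 : ℝ), ∀ c : ℝ, 0 < c → c ≤ 1 →
      ∀ r ∈ KSet M q ℓ (fun x => (φ - taylorPoly φ k) (c • x)), r ≤ D * c ^ k := by
  have hg : ContDiff ℝ (⊤ : ℕ∞) (φ - taylorPoly φ k) := hφ.sub (contDiff_taylorPoly φ k)
  obtain ⟨B, hB0, hB⟩ := exists_bound_of_knormFin hM hℓ h
  have hW : ∀ p, 0 < ℓ ^ p * M p := fun p => mul_pos (pow_pos hℓ _) (hM _)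
  have hhigh : ∀ α, k ≤ mOrd α → mderiv α (φ - taylorPoly φ k) = mderiv α φ := fun α hα => by
    rw [mderiv_sub hφ (contDiff_taylorPoly φ k), mderiv_taylorPoly_of_le φ hα, sub_zero]
  have hlow := norm_mderiv_le_of_vanishing hg (k := k) (m := q - k)
    (mul_nonneg hB0 (hW k).le)
    (fun α hα => by
      rw [mderiv_sub hφ (contDiff_taylorPoly φ k), Pi.sub_apply, mderiv_taylorPoly_zero φ hα,
        sub_self])
    (fun α hα y => by
      rw [hhigh α hα.ge]
      have := hB α y
      rwa [hα, ← Nat.cast_sub hkq, zpow_natCast] at this)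
  set E : ℕ → ℝ := fun a => B * (ℓ ^ k * M k) * d ^ (k - a) / (ℓ ^ a * M a)
  have hE0 : ∀ a, 0 ≤ E a := fun a =>
    div_nonneg (mul_nonneg (mul_nonneg hB0 (hW k).le) (by positivity)) (hW a).le
  refine ⟨B + ∑ a ∈ Finset.range k, E a,
    add_nonneg hB0 (Finset.sum_nonneg fun a _ => hE0 a), ?_⟩
  rintro c hc hc1 _ ⟨α, x, rfl⟩
  have hx : ‖c • x‖ = c * ‖x‖ := by rw [norm_smul, Real.norm_of_nonneg hc.le]
  rw [mderiv_comp_smul hg, norm_mul, norm_pow, Complex.norm_real, Real.norm_of_nonneg hc.le,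
    div_le_iff₀ (hW _)]
  rcases le_or_gt k (mOrd α) with hα | hα
  · have h1 := hB α (c • x)
    rw [hx] at h1
    rw [hhigh α hα]
    calc (1 + ‖x‖) ^ ((mOrd α : ℤ) - q) * (c ^ mOrd α * ‖mderiv α φ (c • x)‖)
        ≤ (1 + ‖x‖) ^ ((mOrd α : ℤ) - q) * (c ^ mOrd α * (B * (ℓ ^ mOrd α * M (mOrd α)) *
            (1 + c * ‖x‖) ^ ((q : ℤ) - mOrd α))) := by gcongr
      _ = B * (ℓ ^ mOrd α * M (mOrd α)) * ((1 + ‖x‖) ^ ((mOrd α : ℤ) - q) * (c ^ mOrd α *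
            (1 + c * ‖x‖) ^ ((q : ℤ) - mOrd α))) := by ring
      _ ≤ B * (ℓ ^ mOrd α * M (mOrd α)) * c ^ k :=
          mul_le_mul_of_nonneg_left (zpow_mul_pow_mul_zpow_le hkq hα hc hc1 (norm_nonneg x))
            (mul_nonneg hB0 (hW _).le)
      _ = B * (c ^ k * (ℓ ^ mOrd α * M (mOrd α))) := by ring
      _ ≤ (B + ∑ a ∈ Finset.range k, E a) * (c ^ k * (ℓ ^ mOrd α * M (mOrd α))) :=
          mul_le_mul_of_nonneg_right
            (le_add_of_nonneg_right (Finset.sum_nonneg fun a _ => hE0 a))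
            (mul_nonneg (by positivity) (hW _).le)
      _ = _ := by ring
  · have h1 := hlow (k - mOrd α) α (by omega) (c • x)
    rw [hx] at h1
    have hEα : E (mOrd α) * (ℓ ^ mOrd α * M (mOrd α)) =
        B * (ℓ ^ k * M k) * d ^ (k - mOrd α) := div_mul_cancel₀ _ (hW _).ne'
    calc (1 + ‖x‖) ^ ((mOrd α : ℤ) - q) *
          (c ^ mOrd α * ‖mderiv α (φ - taylorPoly φ k) (c • x)‖)
        ≤ (1 + ‖x‖) ^ ((mOrd α : ℤ) - q) * (c ^ mOrd α * (B * (ℓ ^ k * M k) *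
            d ^ (k - mOrd α) * (c * ‖x‖) ^ (k - mOrd α) * (1 + c * ‖x‖) ^ (q - k))) := by gcongr
      _ = E (mOrd α) * (ℓ ^ mOrd α * M (mOrd α)) * ((1 + ‖x‖) ^ ((mOrd α : ℤ) - q) *
            (c ^ mOrd α * ((c * ‖x‖) ^ (k - mOrd α) * (1 + c * ‖x‖) ^ (q - k)))) := by
          rw [hEα]; ring
      _ ≤ E (mOrd α) * (ℓ ^ mOrd α * M (mOrd α)) * c ^ k :=
          mul_le_mul_of_nonneg_left (zpow_mul_pow_mul_pow_le hkq hα.le hc hc1 (norm_nonneg x))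
            (mul_nonneg (hE0 _) (hW _).le)
      _ = E (mOrd α) * (c ^ k * (ℓ ^ mOrd α * M (mOrd α))) := by ring
      _ ≤ (B + ∑ a ∈ Finset.range k, E a) * (c ^ k * (ℓ ^ mOrd α * M (mOrd α))) := by
          refine mul_le_mul_of_nonneg_right ?_ (mul_nonneg (by positivity) (hW _).le)
          have := Finset.single_le_sum (fun a _ => hE0 a) (Finset.mem_range.mpr hα)
          linarith
      _ = _ := by ring

/-- every `f ∈ K'^{(M_p)}(ℝ^d)` satisfies the moment asymptotic
expansion in `K'^{(M_p)}(ℝ^d)` with moments `μ_α = ⟨f, x^α⟩`. -/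
theorem stmt14 {d : ℕ} (M : ℕ → ℝ) (hM1 : IsM1 M)
    (f : (Rd d → ℂ) →ₗ[ℂ] ℂ) (hf : IsKDual M f) :
    ∀ φ : Rd d → ℂ, IsKTest M φ → ∀ k : ℕ, ∃ C > (0 : ℝ), ∃ Λ > (0 : ℝ),
      ∀ lam : ℝ, Λ ≤ lam →
        ‖((lam : ℂ) ^ d)⁻¹ * f (fun x => φ (lam⁻¹ • x)) -
          ∑ α ∈ momIdx d k, f (monomial α) * mderiv α φ 0 /
            ((mFact α : ℂ) * (lam : ℂ) ^ (mOrd α + d))‖ ≤ C / lam ^ (k + d) := by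
  rintro φ ⟨hφ, q₀, hq₀⟩ k
  have hM := hM1.1
  set q := max q₀ k
  have hfin : ∀ ℓ > (0 : ℝ), KnormFin M q ℓ φ := fun ℓ hℓ =>
    (hq₀ ℓ hℓ).mono hM (le_max_left _ _) hℓ
  obtain ⟨ℓ, hℓ, C, hC, hfC⟩ := hf q
  obtain ⟨D, hD0, hD⟩ := exists_remainder_bound hM (le_max_right q₀ k) hℓ hφ (hfin ℓ hℓ)
  refine ⟨C * D + 1, by positivity, 1, one_pos, fun lam hlam => ?_⟩
  have hlam0 : 0 < lam := one_pos.trans_le hlam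
  have hinv1 : lam⁻¹ ≤ 1 := inv_le_one_of_one_le₀ hlam
  have hlamC : (lam : ℂ) ≠ 0 := by exact_mod_cast hlam0.ne'
  set R : Rd d → ℂ := fun x => (φ - taylorPoly φ k) (lam⁻¹ • x) with hR
  have hRsmooth : ContDiff ℝ (⊤ : ℕ∞) R :=
    (hφ.sub (contDiff_taylorPoly φ k)).comp (contDiff_const_smul lam⁻¹)
  have hRfin : ∀ ℓ' > (0 : ℝ), KnormFin M q ℓ' R := by
    intro ℓ' hℓ'
    obtain ⟨D', -, hD'⟩ := exists_remainder_bound hM (le_max_right q₀ k) hℓ' hφ (hfin ℓ' hℓ')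
    exact ⟨_, hD' lam⁻¹ (inv_pos.mpr hlam0) hinv1⟩
  have hRnorm : Knorm M q ℓ R ≤ D * lam⁻¹ ^ k :=
    csSup_le ⟨_, 0, 0, rfl⟩ (hD lam⁻¹ (inv_pos.mpr hlam0) hinv1)
  have hfR : ‖f R‖ ≤ C * (D * lam⁻¹ ^ k) :=
    (hfC R hRsmooth hRfin).trans (mul_le_mul_of_nonneg_left hRnorm hC.le)
  have hRdecomp : R = (fun x => φ (lam⁻¹ • x)) -
      ∑ α ∈ momIdx d k, (mderiv α φ 0 / mFact α * ((lam : ℂ) ^ mOrd α)⁻¹) • monomial α := by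
    funext x
    simp [hR, taylorPoly, monomial_smul, mul_assoc]
  have key : ((lam : ℂ) ^ d)⁻¹ * f (fun x => φ (lam⁻¹ • x)) -
      ∑ α ∈ momIdx d k, f (monomial α) * mderiv α φ 0 /
        ((mFact α : ℂ) * (lam : ℂ) ^ (mOrd α + d)) = ((lam : ℂ) ^ d)⁻¹ * f R := by
    rw [hRdecomp, map_sub, map_sum, mul_sub, Finset.mul_sum]
    congr 1
    refine Finset.sum_congr rfl fun α _ => ?_
    rw [map_smul, smul_eq_mul, pow_add, div_eq_mul_inv, div_eq_mul_inv, mul_inv, mul_inv]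
    ring
  rw [key, norm_mul, norm_inv, norm_pow, Complex.norm_real, Real.norm_of_nonneg hlam0.le]
  calc (lam ^ d)⁻¹ * ‖f R‖ ≤ (lam ^ d)⁻¹ * (C * (D * lam⁻¹ ^ k)) := by gcongr
    _ = C * D / lam ^ (k + d) := by
        rw [pow_add, div_eq_mul_inv, mul_inv, inv_pow]
        ring
    _ ≤ _ := by gcongr; linarith
end
end
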